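/- Linear mixing for locally informed proposals: Assume the model and Bayesian CART prior with p_{lk} = n^{-c}, c > 3, consider the Twiggy Bayesian CART chain with the informed (LIT-MH) proposal, and let L = L(n) ≤ L_max with L(n) → ∞ as n → ∞. Under Assumption 1 (case (a) or (b)) with a sufficiently large constant A > 0, there is a universal constant c₀ such that for all sufficiently large n, with probability at least 1 − 4/n − e^{−n/8} over ε ~ N(0, I_n), τ_ε ≤ c₀ · log(6/ε) · max( (9(C_{f_0}+2)²/A²) · 2^L n / log²n , 2^{L+5} ). For the informed Bayesian CART chain the same bound holds, but only under Assumption 1(a). -/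

import Mathlib

open Finset MeasureTheory Real
open scoped BigOperators NNReal ENNReal

noncomputable section

namespace BayesCART

/-! ## Trees

Nodes of the dyadic (Haar wavelet) tree are encoded by the index `j = 2^l + k`
(the root `ψ_{-1,0}` is `j = 0`, and `ψ_{l,k} ↦ 2^l + k` for `l ≥ 0`, `0 ≤ k < 2^l`).
The children of a node `j ≥ 1` are `2j` and `2j+1`, the unique child of the root `0`
is `1`, and the parent of `j ≥ 1` is `j / 2`.  A tree is identified with the finite
set `S` of its internal nodes, which must contain the root and be ancestor-closed. -/

/-- `S` is the internal-node set of a tree all of whose internal nodes have depth `< L`. -/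
def IsTree (L : ℕ) (S : Finset ℕ) : Prop :=
  0 ∈ S ∧ (∀ j ∈ S, 1 ≤ j → j / 2 ∈ S) ∧ ∀ j ∈ S, j < 2 ^ L

instance (L : ℕ) : DecidablePred (IsTree L) := fun _ => by unfold IsTree; infer_instance

/-- The (finite) collection `𝕋_L` of all trees with internal nodes of depth `< L`. -/
def trees (L : ℕ) : Finset (Finset ℕ) :=
  (Finset.range (2 ^ L)).powerset.filter (IsTree L)

/-- The external (leaf) nodes `𝒯_ext` of the tree with internal nodes `S`. -/
def extSet (S : Finset ℕ) : Finset ℕ :=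
  ((S.image fun j => 2 * j) ∪ S.image fun j => 2 * j + 1).filter fun j => j ∉ S

/-! ## The Haar design -/

/-- The Haar mother wavelet `ψ = 1_{(0,1/2]} − 1_{(1/2,1]}`. -/
def haarMother (x : ℝ) : ℝ :=
  if 0 < x ∧ x ≤ 1 / 2 then 1 else if 1 / 2 < x ∧ x ≤ 1 then -1 else 0

/-- Entry `i` of column `j` of the Haar design matrix with `n` observations at the
design points `x_i = (i+1)/n`: column `j = 0` is `ψ_{-1,0} ≡ 1`, and column
`j = 2^l + k ≥ 1` is `ψ_{lk}(x) = 2^{l/2} ψ(2^l x − k)`. -/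
def haarCol (n j i : ℕ) : ℝ :=
  if j = 0 then 1
  else
    (2 : ℝ) ^ ((Nat.log 2 j : ℝ) / 2) *
      haarMother ((2 : ℝ) ^ (Nat.log 2 j) * ((i + 1 : ℝ) / n) - ((j - 2 ^ Nat.log 2 j : ℕ) : ℝ))

/-- The inner product `X_j' Y` of the `j`-th design column with a vector `Y ∈ ℝⁿ`. -/
def colDot (n : ℕ) (Y : Fin n → ℝ) (j : ℕ) : ℝ := ∑ i : Fin n, haarCol n j i.val * Y i

/-- The vector `X β* = Σ_{j ∈ B} β*_j ψ_j` of values of `f₀` at the design points. -/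
def signalVec (n : ℕ) (β : ℕ → ℝ) (B : Finset ℕ) : Fin n → ℝ :=
  fun i => ∑ j ∈ B, β j * haarCol n j i.val

/-- The response `Y = X β* + ε`. -/
def Yvec (n : ℕ) (β : ℕ → ℝ) (B : Finset ℕ) (ε : Fin n → ℝ) : Fin n → ℝ :=
  fun i => signalVec n β B i + ε i

/-- The standard Gaussian measure of `ε = (ε_1, …, ε_n) ~ N(0, I_n)`. -/
def gauss (n : ℕ) : Measure (Fin n → ℝ) :=
  Measure.pi fun _ => ProbabilityTheory.gaussianReal 0 1

/-! ## Prior and posterior -/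

/-- The split probability `p_{lk} = n^{-c}`. -/
def splitP (n : ℕ) (c : ℝ) : ℝ := (n : ℝ) ^ (-c)

/-- Unnormalized Galton–Watson tree prior `Π(𝒯) ∝ ∏_{int} p ∏_{ext} (1 − p)`
with constant split probability `p`. -/
def priorWt (p : ℝ) (S : Finset ℕ) : ℝ := p ^ S.card * (1 - p) ^ (extSet S).card

/-- The marginal likelihood
`N_Y(𝒯) = (2π)^{-n/2} (1+n)^{-|𝒯_ext|/2} exp{−½ Y'[I − X_𝒯 Σ_𝒯 X_𝒯'] Y}`;
for the orthogonal Haar design (`X'X = nI`) with `Σ_𝒯 = (n/(n+1))(X_𝒯'X_𝒯)^{-1}`,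
`Y' X_𝒯 Σ_𝒯 X_𝒯' Y = (n+1)^{-1} Σ_{j ∈ 𝒯_int} (X_j'Y)²`. -/
def margLik (n : ℕ) (Y : Fin n → ℝ) (S : Finset ℕ) : ℝ :=
  (2 * π) ^ (-(n : ℝ) / 2) * ((1 + n : ℝ) ^ (-((extSet S).card : ℝ) / 2)) *
    Real.exp (-(1 / 2) * ((∑ i, Y i ^ 2) - (1 / ((n : ℝ) + 1)) * ∑ j ∈ S, colDot n Y j ^ 2))

/-- Unnormalized posterior weight `Π(𝒯) N_Y(𝒯)`. -/
def postWt (n : ℕ) (p : ℝ) (Y : Fin n → ℝ) (S : Finset ℕ) : ℝ :=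
  priorWt p S * margLik n Y S

/-- Posterior probability `Π(𝒯 ∣ Y)` of a single tree in `𝕋_L`. -/
def post (L n : ℕ) (p : ℝ) (Y : Fin n → ℝ) (S : Finset ℕ) : ℝ :=
  postWt n p Y S / ∑ T ∈ trees L, postWt n p Y T

/-- Posterior probability of a family of trees. -/
def postSet (L n : ℕ) (p : ℝ) (Y : Fin n → ℝ) (A : Finset (Finset ℕ)) : ℝ :=
  ∑ T ∈ A ∩ trees L, post L n p Y T

/-! ## Assumption 1 -/

/-- Assumption 1: `f₀ = Σ_{(l,k) ∈ ℬ} β*_{lk} ψ_{lk}` with all signal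
coefficients of magnitude in `(A log n / √n, C)`, and `𝒯* ∈ 𝕋_L` is the smallest
tree containing `ℬ` among its internal nodes. -/
structure Assumption1 (L n : ℕ) (A C : ℝ) (β : ℕ → ℝ) (B Sstar : Finset ℕ) : Prop where
  B_depth : ∀ j ∈ B, j < 2 ^ L
  signal_low : ∀ j ∈ B, A * Real.log n / Real.sqrt n < |β j|
  signal_high : ∀ j ∈ B, |β j| < C
  support : ∀ j, j ∉ B → β j = 0
  Sstar_tree : Sstar ∈ trees L
  Sstar_contains : B ⊆ Sstar
  Sstar_min : ∀ T ∈ trees L, B ⊆ T → Sstar ⊆ T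

/-! ## The Bayesian CART proposal -/

/-- GROW candidates: external nodes of depth `< L`. -/
def growCands (L : ℕ) (S : Finset ℕ) : Finset ℕ := (extSet S).filter fun j => j < 2 ^ L

/-- PRUNE candidates: pre-terminal internal nodes (no children internal), root excluded. -/
def pruneCands (S : Finset ℕ) : Finset ℕ :=
  S.filter fun j => j ≠ 0 ∧ 2 * j ∉ S ∧ 2 * j + 1 ∉ S

/-- The GROW/PRUNE proposal kernel of (dyadic) Bayesian CART: GROW and PRUNE are
chosen with probability `1/2` each (with forced moves at the null and the full tree),
a GROW splits a uniformly chosen external node, and a PRUNE collapses a uniformly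
chosen pre-terminal node. -/
def bcartProp (L : ℕ) (S S' : Finset ℕ) : ℝ :=
  (if (pruneCands S).Nonempty then (1 : ℝ) / 2 else 1) *
      (((growCands L S).filter fun j => insert j S = S').card / (growCands L S).card)
    + (if (growCands L S).Nonempty then (1 : ℝ) / 2 else 1) *
      (((pruneCands S).filter fun j => S.erase j = S').card / (pruneCands S).card)

/-! ## Metropolis–Hastings machinery -/

/-- The Metropolis–Hastings transition matrix on `𝕋_L` with target `π₀` and proposal `q`. -/
def mhTrans (L : ℕ) (π₀ : Finset ℕ → ℝ) (q : Finset ℕ → Finset ℕ → ℝ)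
    (S S' : Finset ℕ) : ℝ :=
  if S' = S then
    1 - ∑ T ∈ (trees L).erase S, q S T * min 1 ((π₀ T * q T S) / (π₀ S * q S T))
  else q S S' * min 1 ((π₀ S' * q S' S) / (π₀ S * q S S'))

/-- The lazy modification `(P + I)/2` of a transition matrix. -/
def lazy (P : Finset ℕ → Finset ℕ → ℝ) (S S' : Finset ℕ) : ℝ :=
  (1 / 2) * P S S' + if S' = S then 1 / 2 else 0

/-- `t`-step transition probabilities over the state space `𝕋_L`. -/
def iterP (L : ℕ) (P : Finset ℕ → Finset ℕ → ℝ) : ℕ → Finset ℕ → Finset ℕ → ℝ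
  | 0, S, S' => if S' = S then 1 else 0
  | t + 1, S, S' => ∑ T ∈ trees L, iterP L P t S T * P T S'

/-- Total variation distance `‖P^t(S, ·) − Π(· ∣ Y)‖_TV` between the chain at time `t`
started at `S` and the posterior. -/
def tvDist (L n : ℕ) (p : ℝ) (Y : Fin n → ℝ) (P : Finset ℕ → Finset ℕ → ℝ)
    (t : ℕ) (S : Finset ℕ) : ℝ :=
  (1 / 2) * ∑ T ∈ trees L, |iterP L P t S T - post L n p Y T|

/-- The `ε`-mixing time `τ_ε = max_{𝒯 ∈ 𝕋_L} min{t : Δ_𝒯(t') ≤ ε for all t' ≥ t}`. -/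
def mixTime (L n : ℕ) (p : ℝ) (Y : Fin n → ℝ) (P : Finset ℕ → Finset ℕ → ℝ) (ε : ℝ) : ℕ :=
  sInf {t | ∀ t' ≥ t, ∀ S ∈ trees L, tvDist L n p Y P t' S ≤ ε}

/-- The (non-lazy) Bayesian CART Metropolis–Hastings transition matrix. -/
def bcartP (L n : ℕ) (c : ℝ) (Y : Fin n → ℝ) : Finset ℕ → Finset ℕ → ℝ :=
  mhTrans L (post L n (splitP n c) Y) (bcartProp L)

end BayesCART
namespace BayesCART

/-! ## Twigs and the Twiggy proposal -/

/-- `isAnc a b`: node `a` is a strict ancestor of node `b`. -/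
def isAnc (a b : ℕ) : Prop := ∃ t ∈ Finset.Icc 1 b, b / 2 ^ t = a

instance (a b : ℕ) : Decidable (isAnc a b) := by unfold isAnc; infer_instance

/-- All nodes on the ancestral path from node `j` up to the root (including `j`). -/
def ancPath (j : ℕ) : Finset ℕ := (Finset.range (j + 1)).image fun t => j / 2 ^ t

/-- The tree obtained from `S` by growing, from the closest external node,
the twig ending at the node `j`: the smallest tree containing `S ∪ {j}`. -/
def growTwig (S : Finset ℕ) (j : ℕ) : Finset ℕ := S ∪ ancPath j

/-- The internal descendants of `j` inside the tree `S`. -/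
def descIn (S : Finset ℕ) (j : ℕ) : Finset ℕ := S.filter fun m => isAnc j m

/-- Twiggy PRUNE candidates: non-root internal nodes whose internal descendants
form a twig (a chain in the ancestry order). -/
def twigPruneCands (S : Finset ℕ) : Finset ℕ :=
  S.filter fun j => j ≠ 0 ∧
    ∀ a ∈ descIn S j, ∀ b ∈ descIn S j, a = b ∨ isAnc a b ∨ isAnc b a

/-- The tree obtained by the Twiggy PRUNE at `j`: remove `j` and all of its descendants. -/
def pruneTwig (S : Finset ℕ) (j : ℕ) : Finset ℕ := S \ insert j (descIn S j)

/-- Nodes of layer (depth) `l` missing from `S`. -/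
def layerNodes (S : Finset ℕ) (l : ℕ) : Finset ℕ :=
  (Finset.Ico (2 ^ l) (2 ^ (l + 1))).filter fun j => j ∉ S

/-- Probability `d_{l} = D^{-l} / Σ_{l' ∈ E} D^{-l'}` of picking layer `l` among the
eligible layers. -/
def layerWt (D : ℝ) (L : ℕ) (S : Finset ℕ) (l : ℕ) : ℝ :=
  D ^ (-(l : ℝ)) /
    ∑ l' ∈ (Finset.range L).filter (fun l' => (layerNodes S l').Nonempty), D ^ (-(l' : ℝ))

/-- The Twiggy Bayesian CART proposal kernel: GROW picks a layer with probability
`∝ D^{-l}` then a missing node uniformly within the layer and attaches the whole twig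
to it; PRUNE removes a uniformly chosen twig. -/
def twiggyProp (L : ℕ) (D : ℝ) (S S' : Finset ℕ) : ℝ :=
  (if (twigPruneCands S).Nonempty then (1 : ℝ) / 2 else 1) *
      ∑ l ∈ Finset.range L, layerWt D L S l *
        (((layerNodes S l).filter fun j => growTwig S j = S').card / (layerNodes S l).card)
    + (if ∃ l ∈ Finset.range L, (layerNodes S l).Nonempty then (1 : ℝ) / 2 else 1) *
      (((twigPruneCands S).filter fun j => pruneTwig S j = S').card / (twigPruneCands S).card)

/-- The (non-lazy) Twiggy Bayesian CART Metropolis–Hastings transition matrix. -/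
def twiggyP (L n : ℕ) (c D : ℝ) (Y : Fin n → ℝ) : Finset ℕ → Finset ℕ → ℝ :=
  mhTrans L (post L n (splitP n c) Y) (twiggyProp L D)

/-! ## Locally informed (LIT-MH) proposals -/

/-- GROW neighborhood `𝒩_g(𝒯)` of Bayesian CART: one extra internal node. -/
def bNg (L : ℕ) (S : Finset ℕ) : Finset (Finset ℕ) :=
  (growCands L S).image fun j => insert j S

/-- PRUNE neighborhood `𝒩_p(𝒯)` of Bayesian CART: one internal node removed. -/
def bNp (S : Finset ℕ) : Finset (Finset ℕ) := (pruneCands S).image fun j => S.erase j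

/-- GROW neighborhood of Twiggy Bayesian CART: one extra twig. -/
def tNg (L : ℕ) (S : Finset ℕ) : Finset (Finset ℕ) :=
  (((Finset.range (2 ^ L)).filter fun j => j ∉ S)).image fun j => growTwig S j

/-- PRUNE neighborhood of Twiggy Bayesian CART: one twig removed. -/
def tNp (S : Finset ℕ) : Finset (Finset ℕ) := (twigPruneCands S).image fun j => pruneTwig S j

/-- The posterior ratio `B(𝒯, 𝒯̃) = Π(𝒯̃|Y)/Π(𝒯|Y)`. -/
def postRatio (L n : ℕ) (c : ℝ) (Y : Fin n → ℝ) (S S' : Finset ℕ) : ℝ :=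
  post L n (splitP n c) Y S' / post L n (splitP n c) Y S

/-- Informed GROW weight `w_g(𝒯̃|𝒯) = min{Π(𝒯̃|Y)/Π(𝒯|Y), n^{(A² log n)/8}}`. -/
def wg (L n : ℕ) (c A : ℝ) (Y : Fin n → ℝ) (S S' : Finset ℕ) : ℝ :=
  min (postRatio L n c Y S S') ((n : ℝ) ^ ((A ^ 2 * Real.log n) / 8))

/-- Informed PRUNE weight `w_p(𝒯̃|𝒯) = max{1, min{Π(𝒯̃|Y)/Π(𝒯|Y), n^{c−3/2}}}`. -/
def wp (L n : ℕ) (c : ℝ) (Y : Fin n → ℝ) (S S' : Finset ℕ) : ℝ :=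
  max 1 (min (postRatio L n c Y S S') ((n : ℝ) ^ (c - 3 / 2)))

/-- Normalizing constant `Z_g(𝒯)` of the informed GROW proposal. -/
def Zg (L n : ℕ) (c A : ℝ) (Y : Fin n → ℝ) (Ng : Finset ℕ → Finset (Finset ℕ))
    (S : Finset ℕ) : ℝ := ∑ T ∈ Ng S, wg L n c A Y S T

/-- Normalizing constant `Z_p(𝒯)` of the informed PRUNE proposal. -/
def Zp (L n : ℕ) (c : ℝ) (Y : Fin n → ℝ) (Np : Finset ℕ → Finset (Finset ℕ))
    (S : Finset ℕ) : ℝ := ∑ T ∈ Np S, wp L n c Y S T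

/-- The locally informed (LIT-MH) proposal with neighborhoods `Ng`, `Np`. -/
def infProp (L n : ℕ) (c A : ℝ) (Y : Fin n → ℝ)
    (Ng Np : Finset ℕ → Finset (Finset ℕ)) (S S' : Finset ℕ) : ℝ :=
  (1 / 2) * (if S' ∈ Ng S then wg L n c A Y S S' / Zg L n c A Y Ng S else 0)
    + (1 / 2) * (if S' ∈ Np S then wp L n c Y S S' / Zp L n c Y Np S else 0)

/-- The informed Bayesian CART Metropolis–Hastings transition matrix. -/
def infBcartP (L n : ℕ) (c A : ℝ) (Y : Fin n → ℝ) : Finset ℕ → Finset ℕ → ℝ :=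
  mhTrans L (post L n (splitP n c) Y) (infProp L n c A Y (bNg L) bNp)

/-- The informed Twiggy Bayesian CART Metropolis–Hastings transition matrix. -/
def infTwiggyP (L n : ℕ) (c A : ℝ) (Y : Fin n → ℝ) : Finset ℕ → Finset ℕ → ℝ :=
  mhTrans L (post L n (splitP n c) Y) (infProp L n c A Y (tNg L) tNp)

/-! ## Drift functions -/

/-- The first drift function
`V₁(𝒯) = exp{(2^L (C+2)² (n+1))^{-1} · Y'(I − P_𝒯/n)Y}`, where
`Y' P_𝒯 Y = Σ_{j ∈ 𝒯_int} (X_j'Y)²` for the orthogonal Haar design. -/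
def V1 (L n : ℕ) (C : ℝ) (Y : Fin n → ℝ) (S : Finset ℕ) : ℝ :=
  Real.exp ((1 / (2 ^ L * (C + 2) ^ 2 * ((n : ℝ) + 1))) *
    ((∑ i, Y i ^ 2) - (1 / (n : ℝ)) * ∑ j ∈ S, colDot n Y j ^ 2))

/-- The second drift function
`V₂(𝒯) = exp{2^{-L}(|𝒯_int ∖ 𝒯*_int| + min(|𝒯*_int ∖ 𝒯_int|,1)·(2^L − |𝒯_int ∪ 𝒯*_int|))}`. -/
def V2 (L : ℕ) (Sstar S : Finset ℕ) : ℝ :=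
  Real.exp ((1 / 2 ^ L) * (((S \ Sstar).card : ℝ) +
    min (((Sstar \ S).card : ℝ)) 1 * ((2 ^ L : ℝ) - ((S ∪ Sstar).card : ℝ))))

/-- Drift ratio `R(𝒯, 𝒯̃) = V(𝒯̃)/V(𝒯) − 1`. -/
def driftR (V : Finset ℕ → ℝ) (S S' : Finset ℕ) : ℝ := V S' / V S - 1

/-- `(PV)(𝒯) = Σ_{𝒯̃ ∈ 𝕋_L} V(𝒯̃) P(𝒯, 𝒯̃)`. -/
def PV (L : ℕ) (P : Finset ℕ → Finset ℕ → ℝ) (V : Finset ℕ → ℝ) (S : Finset ℕ) : ℝ :=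
  ∑ T ∈ trees L, V T * P S T

/-! ## Canonical paths -/

/-- The Bayesian CART canonical transition map `𝒢` toward `𝒯*`: if the tree has
redundant internal nodes, remove the deepest rightmost one (maximal `j = 2^l + k`);
otherwise (when `𝒯 ⊂ 𝒯*`) add the deepest rightmost external node lying in `𝒯*_int`. -/
def gMap (Sstar S : Finset ℕ) : Finset ℕ :=
  if S = Sstar then S
  else
    match (S \ Sstar).max with
    | some j => S.erase j
    | none =>
      match ((extSet S) ∩ Sstar).max with
      | some j => insert j S
      | none => S

/-- The Twiggy canonical transition map toward `𝒯*`: if the tree has redundant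
internal nodes, remove the shallowest leftmost one whose internal descendants form a
twig, together with its whole twig of descendants; otherwise grow the twig toward the
deepest rightmost node of `𝒯*_int` missing from `𝒯`. -/
def gTwig (Sstar S : Finset ℕ) : Finset ℕ :=
  if S = Sstar then S
  else
    match ((S \ Sstar).filter fun j =>
        ∀ a ∈ descIn S j, ∀ b ∈ descIn S j, a = b ∨ isAnc a b ∨ isAnc b a).min with
    | some j => pruneTwig S j
    | none =>
      match (Sstar \ S).max with
      | some j => growTwig S j
      | none => S

/-- The set of states on the canonical path from `S` to `𝒯*` (iterating the
transition map `g`; `g` fixes `𝒯*`, and the fuel `2^(2L+2)` is ample). -/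
def pathStates (L : ℕ) (g : Finset ℕ → Finset ℕ) (S : Finset ℕ) : Finset (Finset ℕ) :=
  (Finset.range (2 ^ (2 * L + 2) + 1)).image fun t => g^[t] S

/-- The length `|T_{𝒯,𝒯'}|` of the collapsed canonical path between `𝒯` and `𝒯'`:
the number of states of either path to `𝒯*` that are not on the other path. -/
def pathLen (L : ℕ) (g : Finset ℕ → Finset ℕ) (S S' : Finset ℕ) : ℕ :=
  (pathStates L g S \ pathStates L g S').card + (pathStates L g S' \ pathStates L g S).card

/-- The directed edges traversed by the canonical path from `S` to `𝒯*`. -/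
def pathEdges (L : ℕ) (g : Finset ℕ → Finset ℕ) (S : Finset ℕ) :
    Finset (Finset ℕ × Finset ℕ) :=
  ((Finset.range (2 ^ (2 * L + 2))).image fun t => (g^[t] S, g^[t + 1] S)).filter
    fun e => e.1 ≠ e.2

/-- The edge `e` lies on the collapsed canonical path `T_{𝒯,𝒯'}` (in the forward
direction along `T_{𝒯,𝒯*}`, or backward along `T_{𝒯',𝒯*}`), the common portion of
the two paths being removed. -/
def onPath (L : ℕ) (g : Finset ℕ → Finset ℕ) (e : Finset ℕ × Finset ℕ)
    (S S' : Finset ℕ) : Prop :=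
  (e ∈ pathEdges L g S ∧ e ∉ pathEdges L g S') ∨
    (e.swap ∈ pathEdges L g S' ∧ e.swap ∉ pathEdges L g S)

instance (L : ℕ) (g : Finset ℕ → Finset ℕ) (e : Finset ℕ × Finset ℕ) (S S' : Finset ℕ) :
    Decidable (onPath L g e S S') := by unfold onPath; infer_instance

end BayesCART

namespace BayesCART

/-- Sample size `n = 2^{L_max + 1}` as a function of the maximal resolution. -/
def nOf (m : ℕ) : ℕ := 2 ^ (m + 1)

/-! ## Finite Markov chains on `trees L` -/

section Markov

variable {L : ℕ} {P : Finset ℕ → Finset ℕ → ℝ}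

lemma iterP_nonneg (hP0 : ∀ S ∈ trees L, ∀ T ∈ trees L, 0 ≤ P S T) (t : ℕ) (S : Finset ℕ)
    {T : Finset ℕ} (hT : T ∈ trees L) : 0 ≤ iterP L P t S T := by
  induction t generalizing T with
  | zero => simp only [iterP]; split_ifs <;> norm_num
  | succ t ih =>
    simp only [iterP]
    exact Finset.sum_nonneg fun U hU => mul_nonneg (ih hU) (hP0 U hU T hT)

lemma iterP_sum (hP1 : ∀ S ∈ trees L, ∑ T ∈ trees L, P S T = 1) (t : ℕ) {S : Finset ℕ}
    (hS : S ∈ trees L) : ∑ T ∈ trees L, iterP L P t S T = 1 := by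
  induction t with
  | zero => simp [iterP, hS]
  | succ t ih =>
    simp only [iterP]
    rw [Finset.sum_comm, ← ih]
    refine Finset.sum_congr rfl fun T hT => ?_
    rw [← Finset.mul_sum, hP1 T hT, mul_one]

lemma iterP_le_one (hP0 : ∀ S ∈ trees L, ∀ T ∈ trees L, 0 ≤ P S T)
    (hP1 : ∀ S ∈ trees L, ∑ T ∈ trees L, P S T = 1) (t : ℕ) {S T : Finset ℕ}
    (hS : S ∈ trees L) (hT : T ∈ trees L) : iterP L P t S T ≤ 1 := by
  rw [← iterP_sum hP1 t hS]
  exact Finset.single_le_sum (f := fun T => iterP L P t S T)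
    (fun U hU => iterP_nonneg hP0 t S hU) hT

lemma iterP_add (s t : ℕ) (S : Finset ℕ) {S' : Finset ℕ} (hS' : S' ∈ trees L) :
    iterP L P (s + t) S S' = ∑ T ∈ trees L, iterP L P s S T * iterP L P t T S' := by
  induction t generalizing S' with
  | zero => simp [iterP, hS']
  | succ t ih =>
    rw [← add_assoc]
    simp only [iterP]
    rw [Finset.sum_congr rfl fun U hU => by rw [ih hU]]
    simp only [Finset.sum_mul, Finset.mul_sum, mul_assoc]
    rw [Finset.sum_comm]

lemma iterP_stationary {π₀ : Finset ℕ → ℝ}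
    (hst : ∀ T ∈ trees L, ∑ S ∈ trees L, π₀ S * P S T = π₀ T) (t : ℕ)
    {T : Finset ℕ} (hT : T ∈ trees L) :
    ∑ S ∈ trees L, π₀ S * iterP L P t S T = π₀ T := by
  induction t generalizing T with
  | zero => simp [iterP, hT]
  | succ t ih =>
    simp only [iterP, Finset.mul_sum]
    rw [Finset.sum_comm, ← hst T hT]
    refine Finset.sum_congr rfl fun U hU => ?_
    rw [← ih hU, Finset.sum_mul]
    exact Finset.sum_congr rfl fun S _ => by ring

/-- Return probabilities to a state carrying most of the stationary mass are large. -/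
lemma stationary_mass_return (hP0 : ∀ S ∈ trees L, ∀ T ∈ trees L, 0 ≤ P S T)
    (hP1 : ∀ S ∈ trees L, ∑ T ∈ trees L, P S T = 1) {π₀ : Finset ℕ → ℝ}
    (hπ0 : ∀ S ∈ trees L, 0 ≤ π₀ S) (hπ1 : ∑ S ∈ trees L, π₀ S = 1)
    (hst : ∀ T ∈ trees L, ∑ S ∈ trees L, π₀ S * P S T = π₀ T) {x₀ : Finset ℕ}
    (hx₀ : x₀ ∈ trees L) (t : ℕ) : 2 * π₀ x₀ - 1 ≤ π₀ x₀ * iterP L P t x₀ x₀ := by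
  have h1 := iterP_stationary hst t hx₀
  rw [← Finset.add_sum_erase _ _ hx₀] at h1 hπ1
  have h2 : ∑ S ∈ (trees L).erase x₀, π₀ S * iterP L P t S x₀ ≤ ∑ S ∈ (trees L).erase x₀, π₀ S :=
    Finset.sum_le_sum fun S hS =>
      mul_le_of_le_one_right (hπ0 S (Finset.mem_of_mem_erase hS))
        (iterP_le_one hP0 hP1 t (Finset.mem_of_mem_erase hS) hx₀)
  linarith

/-- If `f` has drift `-η` off `x₀` and at most `b` at `x₀`, where `κ = η + b`, then the
stationary law gives mass at least `η / κ` to `x₀`. -/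
lemma stationary_mass_of_drift {π₀ f : Finset ℕ → ℝ}
    (hπ0 : ∀ S ∈ trees L, 0 ≤ π₀ S) (hπ1 : ∑ S ∈ trees L, π₀ S = 1)
    (hst : ∀ T ∈ trees L, ∑ S ∈ trees L, π₀ S * P S T = π₀ T) {x₀ : Finset ℕ}
    (hx₀ : x₀ ∈ trees L) {η κ : ℝ}
    (hd : ∀ S ∈ trees L, ∑ T ∈ trees L, P S T * f T ≤ f S - η + if S = x₀ then κ else 0) :
    η ≤ κ * π₀ x₀ := by
  have h1 : ∑ S ∈ trees L, π₀ S * ∑ T ∈ trees L, P S T * f T = ∑ T ∈ trees L, π₀ T * f T := by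
    simp only [Finset.mul_sum]
    rw [Finset.sum_comm]
    refine Finset.sum_congr rfl fun T hT => ?_
    rw [← hst T hT, Finset.sum_mul]
    exact Finset.sum_congr rfl fun S _ => by ring
  have h2 : ∑ S ∈ trees L, π₀ S * ∑ T ∈ trees L, P S T * f T
      ≤ ∑ S ∈ trees L, π₀ S * (f S - η + if S = x₀ then κ else 0) :=
    Finset.sum_le_sum fun S hS => mul_le_mul_of_nonneg_left (hd S hS) (hπ0 S hS)
  have h3 : ∑ S ∈ trees L, π₀ S * (f S - η + if S = x₀ then κ else 0)
      = ∑ S ∈ trees L, π₀ S * f S - η + π₀ x₀ * κ := by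
    simp only [mul_add, mul_sub, Finset.sum_add_distrib, Finset.sum_sub_distrib, mul_ite, mul_zero,
      Finset.sum_ite_eq', hx₀, if_true]
    rw [← Finset.sum_mul, hπ1, one_mul]
  linarith

/-- Averaging the drift inequality over time. -/
lemma drift_time_average (hP0 : ∀ S ∈ trees L, ∀ T ∈ trees L, 0 ≤ P S T)
    (hP1 : ∀ S ∈ trees L, ∑ T ∈ trees L, P S T = 1) {f : Finset ℕ → ℝ} {x₀ : Finset ℕ}
    (hx₀ : x₀ ∈ trees L) {η κ : ℝ}
    (hd : ∀ S ∈ trees L, ∑ T ∈ trees L, P S T * f T ≤ f S - η + if S = x₀ then κ else 0)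
    {x : Finset ℕ} (hx : x ∈ trees L) (t : ℕ) :
    ∑ T ∈ trees L, iterP L P t x T * f T ≤
      f x - η * t + κ * ∑ s ∈ Finset.range t, iterP L P s x x₀ := by
  induction t with
  | zero => simp [iterP, hx]
  | succ t ih =>
    have h1 : ∑ T ∈ trees L, iterP L P (t + 1) x T * f T
        = ∑ S ∈ trees L, iterP L P t x S * ∑ T ∈ trees L, P S T * f T := by
      simp only [iterP, Finset.sum_mul, Finset.mul_sum]
      rw [Finset.sum_comm]
      exact Finset.sum_congr rfl fun S _ => Finset.sum_congr rfl fun T _ => by ring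
    have h2 : ∑ S ∈ trees L, iterP L P t x S * ∑ T ∈ trees L, P S T * f T
        ≤ ∑ S ∈ trees L, iterP L P t x S * (f S - η + if S = x₀ then κ else 0) :=
      Finset.sum_le_sum fun S hS =>
        mul_le_mul_of_nonneg_left (hd S hS) (iterP_nonneg hP0 t x hS)
    have h3 : ∑ S ∈ trees L, iterP L P t x S * (f S - η + if S = x₀ then κ else 0)
        = ∑ S ∈ trees L, iterP L P t x S * f S - η + iterP L P t x x₀ * κ := by
      simp only [mul_add, mul_sub, Finset.sum_add_distrib, Finset.sum_sub_distrib, mul_ite,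
        mul_zero, Finset.sum_ite_eq', hx₀, if_true]
      rw [← Finset.sum_mul, iterP_sum hP1 t hx, one_mul]
    rw [Finset.sum_range_succ]
    push_cast
    linarith

/-- Doeblin contraction: a row vector of total mass zero shrinks in `ℓ¹` by `1 - α`. -/
lemma doeblin_contraction (hP0 : ∀ S ∈ trees L, ∀ T ∈ trees L, 0 ≤ P S T)
    (hP1 : ∀ S ∈ trees L, ∑ T ∈ trees L, P S T = 1) {x₀ : Finset ℕ} (hx₀ : x₀ ∈ trees L)
    {α : ℝ} {t : ℕ} (hα : ∀ S ∈ trees L, α ≤ iterP L P t S x₀) {v : Finset ℕ → ℝ}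
    (hv : ∑ S ∈ trees L, v S = 0) :
    ∑ T ∈ trees L, |∑ S ∈ trees L, v S * iterP L P t S T| ≤
      (1 - α) * ∑ S ∈ trees L, |v S| := by
  have h1 : ∀ T ∈ trees L, |∑ S ∈ trees L, v S * iterP L P t S T| ≤
      ∑ S ∈ trees L, |v S| * (iterP L P t S T - if T = x₀ then α else 0) := by
    intro T hT
    have : ∑ S ∈ trees L, v S * iterP L P t S T
        = ∑ S ∈ trees L, v S * (iterP L P t S T - if T = x₀ then α else 0) := by
      simp only [mul_sub, Finset.sum_sub_distrib, ← Finset.sum_mul, hv, zero_mul, sub_zero]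
    rw [this]
    refine (Finset.abs_sum_le_sum_abs _ _).trans (Finset.sum_le_sum fun S hS => ?_)
    have hnn : 0 ≤ iterP L P t S T - if T = x₀ then α else 0 := by
      split_ifs with h
      · rw [h]; linarith [hα S hS]
      · linarith [iterP_nonneg hP0 t S hT]
    rw [abs_mul, abs_of_nonneg hnn]
  refine (Finset.sum_le_sum h1).trans (le_of_eq ?_)
  rw [Finset.sum_comm, Finset.mul_sum]
  refine Finset.sum_congr rfl fun S hS => ?_
  rw [← Finset.mul_sum, Finset.sum_sub_distrib, iterP_sum hP1 t hS]
  simp [hx₀, mul_comm]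

end Markov

/-- Mixing time bound from a drift condition towards a single state. -/
theorem mixTime_le_of_drift {L n : ℕ} {p : ℝ} {Y : Fin n → ℝ} {P : Finset ℕ → Finset ℕ → ℝ}
    (hP0 : ∀ S ∈ trees L, ∀ T ∈ trees L, 0 ≤ P S T)
    (hP1 : ∀ S ∈ trees L, ∑ T ∈ trees L, P S T = 1)
    (hπ0 : ∀ S ∈ trees L, 0 ≤ post L n p Y S) (hπ1 : ∑ S ∈ trees L, post L n p Y S = 1)
    (hst : ∀ T ∈ trees L, ∑ S ∈ trees L, post L n p Y S * P S T = post L n p Y T)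
    {x₀ : Finset ℕ} (hx₀ : x₀ ∈ trees L) {f : Finset ℕ → ℝ} (hf0 : ∀ S ∈ trees L, 0 ≤ f S)
    (hfL : ∀ S ∈ trees L, f S ≤ 2 ^ (L + 1))
    (hd : ∀ S ∈ trees L,
      ∑ T ∈ trees L, P S T * f T ≤ f S - 15 / 64 + if S = x₀ then 1 / 4 else 0)
    {δ : ℝ} (hδ : δ ∈ Set.Ioo (0 : ℝ) 1) :
    (mixTime L n p Y P δ : ℝ) ≤ 6 * Real.log (6 / δ) * 2 ^ (L + 5) := by
  set τ : ℕ := 2 ^ (L + 6) with hτ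
  have hmass := stationary_mass_of_drift hπ0 hπ1 hst hx₀ hd
  have hret : ∀ t, 14 / 15 ≤ iterP L P t x₀ x₀ := by
    intro t
    have h := stationary_mass_return hP0 hP1 hπ0 hπ1 hst hx₀ t
    have h1 := iterP_le_one hP0 hP1 t hx₀ hx₀
    have hle : post L n p Y x₀ ≤ 1 := by
      rw [← hπ1]; exact Finset.single_le_sum (f := fun S => post L n p Y S) hπ0 hx₀
    by_contra hlt
    push Not at hlt
    nlinarith
  have hdoe : ∀ S ∈ trees L, 1 / 2 ≤ iterP L P τ S x₀ := by
    intro S hS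
    obtain ⟨s, hs, hsl⟩ : ∃ s ∈ Finset.range τ, 3 / 4 ≤ iterP L P s S x₀ := by
      by_contra! hcon
      have h1 := drift_time_average hP0 hP1 hx₀ hd hS τ
      have h2 : 0 ≤ ∑ T ∈ trees L, iterP L P τ S T * f T :=
        Finset.sum_nonneg fun T hT => mul_nonneg (iterP_nonneg hP0 τ S hT) (hf0 T hT)
      have h3 : ∑ s ∈ Finset.range τ, iterP L P s S x₀ ≤ ∑ _s ∈ Finset.range τ, (3 / 4 : ℝ) :=
        Finset.sum_le_sum fun s hs => (hcon s hs).le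
      rw [Finset.sum_const, Finset.card_range, nsmul_eq_mul] at h3
      have h4 := hfL S hS
      have h5 : (τ : ℝ) = 32 * 2 ^ (L + 1) := by rw [hτ]; push_cast; ring
      have h6 : (0 : ℝ) < 2 ^ (L + 1) := by positivity
      rw [h5] at h1 h3
      linarith
    have hsτ : s + (τ - s) = τ := by have := Finset.mem_range.mp hs; omega
    rw [← hsτ, iterP_add s (τ - s) S hx₀]
    have h1 : iterP L P s S x₀ * iterP L P (τ - s) x₀ x₀ ≤
        ∑ T ∈ trees L, iterP L P s S T * iterP L P (τ - s) T x₀ :=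
      Finset.single_le_sum (f := fun T => iterP L P s S T * iterP L P (τ - s) T x₀)
        (fun T hT => mul_nonneg (iterP_nonneg hP0 _ _ hT) (iterP_nonneg hP0 _ _ hx₀)) hx₀
    have h2 := hret (τ - s)
    nlinarith
  have hzero : ∀ t, ∀ S ∈ trees L,
      ∑ T ∈ trees L, (iterP L P t S T - post L n p Y T) = 0 := by
    intro t S hS
    rw [Finset.sum_sub_distrib, iterP_sum hP1 t hS, hπ1, sub_self]
  have hstep : ∀ s t, ∀ α : ℝ, (∀ S ∈ trees L, α ≤ iterP L P t S x₀) → ∀ S ∈ trees L,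
      tvDist L n p Y P (s + t) S ≤ (1 - α) * tvDist L n p Y P s S := by
    intro s t α hα S hS
    have h := doeblin_contraction hP0 hP1 hx₀ hα (hzero s S hS)
    have heq : ∀ T ∈ trees L, ∑ U ∈ trees L,
        (iterP L P s S U - post L n p Y U) * iterP L P t U T
          = iterP L P (s + t) S T - post L n p Y T := by
      intro T hT
      simp only [sub_mul, Finset.sum_sub_distrib]
      rw [iterP_add s t S hT, iterP_stationary hst t hT]
    rw [Finset.sum_congr rfl fun T hT => by rw [heq T hT]] at h
    unfold tvDist
    linarith
  have htv0 : ∀ S ∈ trees L, tvDist L n p Y P 0 S ≤ 1 := by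
    intro S hS
    unfold tvDist
    have : ∑ T ∈ trees L, |iterP L P 0 S T - post L n p Y T| ≤
        ∑ T ∈ trees L, (iterP L P 0 S T + post L n p Y T) := by
      refine Finset.sum_le_sum fun T hT => (abs_sub _ _).trans (le_of_eq ?_)
      rw [abs_of_nonneg (iterP_nonneg hP0 0 S hT), abs_of_nonneg (hπ0 T hT)]
    rw [Finset.sum_add_distrib, iterP_sum hP1 0 hS, hπ1] at this
    linarith
  have hgeom : ∀ k : ℕ, ∀ S ∈ trees L, tvDist L n p Y P (k * τ) S ≤ (1 / 2) ^ k := by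
    intro k S hS
    induction k with
    | zero => simpa using htv0 S hS
    | succ k ih =>
      rw [Nat.succ_mul, pow_succ]
      have := hstep (k * τ) τ (1 / 2) hdoe S hS
      linarith
  obtain ⟨hδ0, hδ1⟩ := hδ
  set k : ℕ := ⌈2 * Real.log (6 / δ)⌉₊ with hk
  have hlog6 : 1 ≤ Real.log (6 / δ) := by
    rw [Real.le_log_iff_exp_le (by positivity)]
    have : (6 : ℝ) ≤ 6 / δ := by rw [le_div_iff₀ hδ0]; nlinarith
    linarith [Real.exp_one_lt_d9]
  have hkδ : (1 / 2 : ℝ) ^ k ≤ δ := by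
    have h1 : (1 / 2 : ℝ) ≤ Real.exp (-(1 / 2)) := by
      linarith [Real.add_one_le_exp (-(1 / 2) : ℝ)]
    have h2 : (1 / 2 : ℝ) ^ k ≤ Real.exp (-(1 / 2)) ^ k := pow_le_pow_left₀ (by norm_num) h1 k
    have h3 : 2 * Real.log (6 / δ) ≤ k := Nat.le_ceil _
    have h4 : Real.exp (-(1 / 2)) ^ k ≤ Real.exp (-Real.log (6 / δ)) := by
      rw [← Real.exp_nat_mul]
      exact Real.exp_le_exp.mpr (by linarith)
    rw [Real.exp_neg (Real.log _), Real.exp_log (by positivity), inv_div] at h4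
    linarith
  have hmem : k * τ ∈ {t | ∀ t' ≥ t, ∀ S ∈ trees L, tvDist L n p Y P t' S ≤ δ} := by
    intro t' ht' S hS
    have h1 := hstep (k * τ) (t' - k * τ) 0 (fun S hS => iterP_nonneg hP0 _ _ hx₀) S hS
    rw [Nat.add_sub_cancel' ht'] at h1
    linarith [hgeom k S hS]
  have hle : mixTime L n p Y P δ ≤ k * τ := Nat.sInf_le hmem
  have hkle : (k : ℝ) ≤ 3 * Real.log (6 / δ) := by
    have := Nat.ceil_lt_add_one (a := 2 * Real.log (6 / δ)) (by linarith)
    linarith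
  calc (mixTime L n p Y P δ : ℝ) ≤ ((k * τ : ℕ) : ℝ) := by exact_mod_cast hle
    _ = (k : ℝ) * (2 * 2 ^ (L + 5)) := by rw [hτ]; push_cast; ring
    _ ≤ 3 * Real.log (6 / δ) * (2 * 2 ^ (L + 5)) := by gcongr
    _ = 6 * Real.log (6 / δ) * 2 ^ (L + 5) := by ring

/-! ## Metropolis–Hastings chains -/

section MetropolisHastings

variable {L : ℕ} {π₀ : Finset ℕ → ℝ} {q : Finset ℕ → Finset ℕ → ℝ} {S T : Finset ℕ}

lemma mhTrans_of_ne (h : T ≠ S) :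
    mhTrans L π₀ q S T = q S T * min 1 ((π₀ T * q T S) / (π₀ S * q S T)) := by
  simp [mhTrans, h]

lemma mhTrans_nonneg_of_ne (hπ : ∀ S ∈ trees L, 0 < π₀ S)
    (hq : ∀ S ∈ trees L, ∀ T ∈ trees L, 0 ≤ q S T) (hS : S ∈ trees L) (hT : T ∈ trees L)
    (h : T ≠ S) : 0 ≤ mhTrans L π₀ q S T := by
  rw [mhTrans_of_ne h]
  have := hq S hS T hT
  have := hq T hT S hS
  have := hπ S hS
  have := hπ T hT
  positivity

lemma mhTrans_self_add :
    mhTrans L π₀ q S S + ∑ T ∈ (trees L).erase S, mhTrans L π₀ q S T = 1 := by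
  rw [Finset.sum_congr rfl fun T hT => mhTrans_of_ne (Finset.ne_of_mem_erase hT)]
  simp [mhTrans]

lemma mhTrans_sum (hS : S ∈ trees L) : ∑ T ∈ trees L, mhTrans L π₀ q S T = 1 := by
  rw [← Finset.add_sum_erase _ _ hS, mhTrans_self_add]

lemma mhTrans_nonneg (hπ : ∀ S ∈ trees L, 0 < π₀ S)
    (hq : ∀ S ∈ trees L, ∀ T ∈ trees L, 0 ≤ q S T)
    (hq1 : ∀ S ∈ trees L, ∑ T ∈ trees L, q S T ≤ 1) (hS : S ∈ trees L) (hT : T ∈ trees L) :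
    0 ≤ mhTrans L π₀ q S T := by
  by_cases h : T = S
  · subst h
    have h1 := mhTrans_self_add (L := L) (π₀ := π₀) (q := q) (S := T)
    have h2 : ∑ U ∈ (trees L).erase T, mhTrans L π₀ q T U ≤ ∑ U ∈ trees L, q T U := by
      refine (Finset.sum_le_sum fun U hU => ?_).trans
        (Finset.sum_le_sum_of_subset_of_nonneg (Finset.erase_subset T _)
          fun U hU _ => hq T hT U hU)
      rw [mhTrans_of_ne (Finset.ne_of_mem_erase hU)]
      exact mul_le_of_le_one_right (hq T hT U (Finset.mem_of_mem_erase hU)) (min_le_left _ _)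
    linarith [hq1 T hT]
  · exact mhTrans_nonneg_of_ne hπ hq hS hT h

lemma mul_mhTrans_of_ne (hπ : ∀ S ∈ trees L, 0 < π₀ S)
    (hq : ∀ S ∈ trees L, ∀ T ∈ trees L, 0 ≤ q S T) (hS : S ∈ trees L) (hT : T ∈ trees L)
    (h : T ≠ S) : π₀ S * mhTrans L π₀ q S T = min (π₀ S * q S T) (π₀ T * q T S) := by
  rw [mhTrans_of_ne h]
  rcases (hq S hS T hT).eq_or_lt with h0 | h0
  · rw [← h0]
    simp [mul_nonneg (hπ T hT).le (hq T hT S hS)]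
  · have h1 : 0 < π₀ S * q S T := mul_pos (hπ S hS) h0
    rw [← mul_assoc, mul_min_of_nonneg _ _ h1.le, mul_one, mul_div_cancel₀ _ h1.ne']

lemma mhTrans_detailed_balance (hπ : ∀ S ∈ trees L, 0 < π₀ S)
    (hq : ∀ S ∈ trees L, ∀ T ∈ trees L, 0 ≤ q S T) (hS : S ∈ trees L) (hT : T ∈ trees L) :
    π₀ S * mhTrans L π₀ q S T = π₀ T * mhTrans L π₀ q T S := by
  by_cases h : T = S
  · rw [h]
  · rw [mul_mhTrans_of_ne hπ hq hS hT h, mul_mhTrans_of_ne hπ hq hT hS (Ne.symm h), min_comm]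

lemma mhTrans_stationary (hπ : ∀ S ∈ trees L, 0 < π₀ S)
    (hq : ∀ S ∈ trees L, ∀ T ∈ trees L, 0 ≤ q S T) (hT : T ∈ trees L) :
    ∑ S ∈ trees L, π₀ S * mhTrans L π₀ q S T = π₀ T := by
  rw [Finset.sum_congr rfl fun S hS => mhTrans_detailed_balance hπ hq hS hT, ← Finset.mul_sum,
    mhTrans_sum hT, mul_one]

/-- A move to a less likely state is rarely accepted, whatever the proposal. -/
lemma mhTrans_le_of_le (hπ : ∀ S ∈ trees L, 0 < π₀ S)
    (hq : ∀ S ∈ trees L, ∀ T ∈ trees L, 0 ≤ q S T) (hS : S ∈ trees L) (hT : T ∈ trees L)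
    (h : T ≠ S) (hq1 : q T S ≤ 1) {K : ℝ} (hK : 0 < K) (hle : K * π₀ T ≤ π₀ S) :
    mhTrans L π₀ q S T ≤ 1 / K := by
  have h1 : π₀ S * mhTrans L π₀ q S T ≤ π₀ T := by
    rw [mul_mhTrans_of_ne hπ hq hS hT h]
    exact (min_le_right _ _).trans (mul_le_of_le_one_right (hπ T hT).le hq1)
  rw [le_div_iff₀ hK]
  have hpos := hπ S hS
  have h0 := mhTrans_nonneg_of_ne hπ hq hS hT h
  by_contra hlt
  push Not at hlt
  nlinarith

lemma mhTrans_eq_prop (hπ : ∀ S ∈ trees L, 0 < π₀ S)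
    (hq : ∀ S ∈ trees L, ∀ T ∈ trees L, 0 ≤ q S T) (hS : S ∈ trees L) (hT : T ∈ trees L)
    (h : T ≠ S) (hle : π₀ S * q S T ≤ π₀ T * q T S) : mhTrans L π₀ q S T = q S T := by
  have h1 := mul_mhTrans_of_ne hπ hq hS hT h
  rw [min_eq_left hle] at h1
  exact mul_left_cancel₀ (hπ S hS).ne' h1

end MetropolisHastings

/-! ## Informed proposals -/

/-- Weights carrying at least half of the total receive proposal mass at least `1/4`. -/
lemma quarter_le_sum_filter {ι : Type*} {N : Finset ι} {w : ι → ℝ} {G : ι → Prop}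
    [DecidablePred G] (hpos : 0 < ∑ i ∈ N, w i)
    (h : ∑ i ∈ N.filter (fun i => ¬ G i), w i ≤ ∑ i ∈ N.filter G, w i) :
    1 / 4 ≤ ∑ i ∈ N.filter G, 1 / 2 * (w i / ∑ i ∈ N, w i) := by
  rw [← Finset.mul_sum, ← Finset.sum_div]
  have h1 := Finset.sum_filter_add_sum_filter_not N G w
  have : 1 / 2 ≤ (∑ i ∈ N.filter G, w i) / ∑ i ∈ N, w i := by
    rw [le_div_iff₀ hpos]; linarith
  linarith

/-- The combinatorial properties of GROW and PRUNE neighborhoods which drive the mixing of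
the informed chain towards the tree `Sstar` spanned by the signal set `B`. -/
structure InformedMoves (L : ℕ) (B Sstar : Finset ℕ) (Ng Np : Finset ℕ → Finset (Finset ℕ)) :
    Prop where
  grow : ∀ S ∈ trees L, ∀ T ∈ Ng S, T ∈ trees L ∧ S ⊂ T ∧ (T \ S).card ≤ L + 1 ∧ S ∈ Np T
  prune : ∀ S ∈ trees L, ∀ T ∈ Np S, T ∈ trees L ∧ T ⊂ S ∧ S ∈ Ng T
  grow_card : ∀ S ∈ trees L, (Ng S).card ≤ 2 ^ L
  prune_card : ∀ S ∈ trees L, (Np S).card ≤ 2 ^ L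
  exists_grow : ∀ S ∈ trees L, ¬ B ⊆ S → ∃ T ∈ Ng S, ¬ Disjoint (T \ S) B
  exists_prune : ∀ S ∈ trees L, B ⊆ S → S ≠ Sstar → ∃ T ∈ Np S, Disjoint (S \ T) B

/-- The drift function: the number of redundant nodes once all signals are found, and
`2 ^ L` plus the number of missing signals before. -/
def driftF (L : ℕ) (B Sstar S : Finset ℕ) : ℝ :=
  if B ⊆ S then ((S \ Sstar).card : ℝ) else 2 ^ L + ((B \ S).card : ℝ)

section Drift

variable {L : ℕ} {B Sstar S T : Finset ℕ}

lemma subset_range_of_mem_trees (hS : S ∈ trees L) : S ⊆ Finset.range (2 ^ L) := by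
  simp only [trees, Finset.mem_filter, Finset.mem_powerset] at hS
  exact hS.1

lemma card_sdiff_le_of_mem_trees (hS : S ∈ trees L) (T : Finset ℕ) :
    ((S \ T).card : ℝ) ≤ 2 ^ L := by
  have h : (S \ T).card ≤ (Finset.range (2 ^ L)).card :=
    Finset.card_le_card (Finset.sdiff_subset.trans (subset_range_of_mem_trees hS))
  rw [Finset.card_range] at h
  exact_mod_cast h

lemma card_signal_sdiff_le (hB : B ⊆ Sstar) (hstar : Sstar ∈ trees L) (T : Finset ℕ) :
    ((B \ T).card : ℝ) ≤ 2 ^ L := by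
  refine le_trans ?_ (card_sdiff_le_of_mem_trees hstar T)
  exact_mod_cast Finset.card_le_card (Finset.sdiff_subset_sdiff hB le_rfl)

lemma driftF_nonneg : 0 ≤ driftF L B Sstar S := by
  unfold driftF; split_ifs <;> positivity

lemma driftF_le (hB : B ⊆ Sstar) (hstar : Sstar ∈ trees L) (hS : S ∈ trees L) :
    driftF L B Sstar S ≤ 2 ^ (L + 1) := by
  have h1 := card_sdiff_le_of_mem_trees hS Sstar
  have h2 := card_signal_sdiff_le hB hstar S
  have h3 : (0 : ℝ) < 2 ^ L := by positivity
  unfold driftF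
  rw [pow_succ]
  split_ifs <;> linarith

lemma driftF_grow_signal (hT : T ∈ trees L) (hST : S ⊂ T) (hS : ¬ B ⊆ S)
    (hsig : ¬ Disjoint (T \ S) B) : driftF L B Sstar T ≤ driftF L B Sstar S - 1 := by
  obtain ⟨j, hj, hjB⟩ := Finset.not_disjoint_iff.mp hsig
  rw [Finset.mem_sdiff] at hj
  have hlt : (B \ T).card < (B \ S).card := by
    refine Finset.card_lt_card (Finset.ssubset_iff_of_subset
      (Finset.sdiff_subset_sdiff le_rfl hST.1) |>.mpr ⟨j, ?_, ?_⟩) <;> simp [hj, hjB]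
  have hlt' : ((B \ T).card : ℝ) + 1 ≤ (B \ S).card := by exact_mod_cast hlt
  have h1 := card_sdiff_le_of_mem_trees hT Sstar
  have h2 : (0 : ℝ) ≤ (B \ T).card := by positivity
  unfold driftF
  rw [if_neg hS]
  split_ifs <;> linarith

lemma subset_of_disjoint_sdiff (hdis : Disjoint (T \ S) B) (hB : B ⊆ T) :
    B ⊆ S := by
  intro j hj
  by_contra hjS
  exact Finset.disjoint_left.mp hdis (Finset.mem_sdiff.mpr ⟨hB hj, hjS⟩) hj

lemma driftF_eq_of_disjoint (hST : S ⊆ T) (hS : ¬ B ⊆ S) (hdis : Disjoint (T \ S) B) :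
    driftF L B Sstar T = driftF L B Sstar S := by
  have hT : ¬ B ⊆ T := fun h => hS (subset_of_disjoint_sdiff hdis h)
  have : B \ T = B \ S := by
    ext j
    simp only [Finset.mem_sdiff]
    refine ⟨fun h => ⟨h.1, fun hj => h.2 (hST hj)⟩, fun h => ⟨h.1, fun hj => ?_⟩⟩
    exact Finset.disjoint_left.mp hdis (Finset.mem_sdiff.mpr ⟨hj, h.2⟩) h.1
  unfold driftF
  rw [if_neg hS, if_neg hT, this]

lemma driftF_grow_noise (hS : B ⊆ S) (hST : S ⊆ T) (hcard : (T \ S).card ≤ L + 1) :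
    driftF L B Sstar T - driftF L B Sstar S ≤ L + 1 := by
  unfold driftF
  rw [if_pos hS, if_pos (hS.trans hST)]
  have h1 : (T \ Sstar).card ≤ (S \ Sstar).card + (T \ S).card := by
    refine (Finset.card_le_card ?_).trans (Finset.card_union_le _ _)
    intro j
    simp only [Finset.mem_sdiff, Finset.mem_union]
    tauto
  have h2 : ((T \ Sstar).card : ℝ) ≤ (S \ Sstar).card + (L + 1) := by
    exact_mod_cast h1.trans (by omega)
  linarith

lemma driftF_prune_noise (hT : B ⊆ T) (hstar : Sstar ⊆ T) (hTS : T ⊂ S) :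
    driftF L B Sstar T ≤ driftF L B Sstar S - 1 := by
  unfold driftF
  rw [if_pos hT, if_pos (hT.trans hTS.1)]
  obtain ⟨j, hjS, hjT⟩ := Finset.exists_of_ssubset hTS
  have hlt : (T \ Sstar).card < (S \ Sstar).card := by
    refine Finset.card_lt_card (Finset.ssubset_iff_of_subset
      (Finset.sdiff_subset_sdiff hTS.1 le_rfl) |>.mpr ⟨j, ?_, ?_⟩)
    · exact Finset.mem_sdiff.mpr ⟨hjS, fun h => hjT (hstar h)⟩
    · exact fun h => hjT (Finset.mem_sdiff.mp h).1
  have : ((T \ Sstar).card : ℝ) + 1 ≤ (S \ Sstar).card := by exact_mod_cast hlt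
  linarith

end Drift

/-- The dichotomy between signal and noise moves under the posterior: moves through noise
nodes lose a factor at least `n ^ (c - 3/2)`, moves through a signal gain at least the cap
`n ^ (A² log n / 8)`. -/
structure PosteriorDichotomy (L n : ℕ) (c A : ℝ) (Y : Fin n → ℝ) (B : Finset ℕ)
    (Ng : Finset ℕ → Finset (Finset ℕ)) : Prop where
  post_pos : ∀ S ∈ trees L, 0 < post L n (splitP n c) Y S
  noise : ∀ S ∈ trees L, ∀ T ∈ trees L, S ⊂ T → Disjoint (T \ S) B →
    (n : ℝ) ^ (c - 3 / 2) * post L n (splitP n c) Y T ≤ post L n (splitP n c) Y S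
  signal : ∀ S ∈ trees L, ∀ T ∈ Ng S, ¬ Disjoint (T \ S) B →
    (n : ℝ) ^ (A ^ 2 * Real.log n / 8) * post L n (splitP n c) Y S ≤ post L n (splitP n c) Y T

/-- The size conditions on `n` used in the drift computation. -/
structure LargeSample (L n : ℕ) (c A : ℝ) : Prop where
  noise_lower : 128 * (2 ^ L * ((L : ℝ) + 1)) ≤ (n : ℝ) ^ (c - 3 / 2)
  cap_lower_noise : 2 ^ L * (n : ℝ) ^ (c - 3 / 2) ≤ (n : ℝ) ^ (A ^ 2 * Real.log n / 8)
  cap_lower : 128 * (2 ^ L * 2 ^ (L + 1)) ≤ (n : ℝ) ^ (A ^ 2 * Real.log n / 8)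

section Informed

variable {L n : ℕ} {c A : ℝ} {Y : Fin n → ℝ} {B Sstar : Finset ℕ}
  {Ng Np : Finset ℕ → Finset (Finset ℕ)} {S T : Finset ℕ}

lemma LargeSample.two_pow_le (hl : LargeSample L n c A) : (2 : ℝ) ^ L ≤ (n : ℝ) ^ (c - 3 / 2) := by
  have h := hl.noise_lower
  have h1 : (0 : ℝ) < 2 ^ L := by positivity
  have h2 : (0 : ℝ) ≤ L := by positivity
  nlinarith

lemma LargeSample.one_le_noise (hl : LargeSample L n c A) : 1 ≤ (n : ℝ) ^ (c - 3 / 2) :=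
  (one_le_pow₀ (by norm_num)).trans hl.two_pow_le

lemma LargeSample.one_le_cap (hl : LargeSample L n c A) :
    1 ≤ (n : ℝ) ^ (A ^ 2 * Real.log n / 8) := by
  have h := hl.cap_lower
  have h1 : (1 : ℝ) ≤ 2 ^ L := one_le_pow₀ (by norm_num)
  have h2 : (1 : ℝ) ≤ 2 ^ (L + 1) := one_le_pow₀ (by norm_num)
  nlinarith

lemma wp_pos : 0 < wp L n c Y S T := zero_lt_one.trans_le (le_max_left _ _)

lemma wp_le (hl : LargeSample L n c A) : wp L n c Y S T ≤ (n : ℝ) ^ (c - 3 / 2) :=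
  max_le hl.one_le_noise (min_le_right _ _)

lemma wg_pos (hd : PosteriorDichotomy L n c A Y B Ng) (hl : LargeSample L n c A)
    (hS : S ∈ trees L) (hT : T ∈ trees L) : 0 < wg L n c A Y S T :=
  lt_min (div_pos (hd.post_pos T hT) (hd.post_pos S hS)) (zero_lt_one.trans_le hl.one_le_cap)

lemma wg_signal (hd : PosteriorDichotomy L n c A Y B Ng) (hS : S ∈ trees L) (hT : T ∈ Ng S)
    (h : ¬ Disjoint (T \ S) B) : wg L n c A Y S T = (n : ℝ) ^ (A ^ 2 * Real.log n / 8) := by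
  refine min_eq_right ?_
  rw [postRatio, le_div_iff₀ (hd.post_pos S hS)]
  exact hd.signal S hS T hT h

lemma postRatio_noise_le (hd : PosteriorDichotomy L n c A Y B Ng) (hl : LargeSample L n c A)
    (hS : S ∈ trees L) (hT : T ∈ trees L) (hST : S ⊂ T) (h : Disjoint (T \ S) B) :
    postRatio L n c Y S T ≤ 1 / (n : ℝ) ^ (c - 3 / 2) := by
  have h0 := hl.one_le_noise
  rw [postRatio, div_le_div_iff₀ (hd.post_pos S hS) (by linarith)]
  linarith [hd.noise S hS T hT hST h]

lemma wg_noise (hd : PosteriorDichotomy L n c A Y B Ng) (hl : LargeSample L n c A)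
    (hS : S ∈ trees L) (hT : T ∈ trees L) (hST : S ⊂ T) (h : Disjoint (T \ S) B) :
    wg L n c A Y S T = postRatio L n c Y S T := by
  refine min_eq_left ?_
  have h0 := hl.one_le_noise
  have h1 : 1 / (n : ℝ) ^ (c - 3 / 2) ≤ 1 := by rw [div_le_one (by linarith)]; exact h0
  linarith [postRatio_noise_le hd hl hS hT hST h, hl.one_le_cap]

lemma wp_noise (hd : PosteriorDichotomy L n c A Y B Ng) (hl : LargeSample L n c A)
    (hS : S ∈ trees L) (hT : T ∈ trees L) (hTS : T ⊂ S) (h : Disjoint (S \ T) B) :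
    wp L n c Y S T = (n : ℝ) ^ (c - 3 / 2) := by
  rw [wp, min_eq_right, max_eq_right hl.one_le_noise]
  rw [postRatio, le_div_iff₀ (hd.post_pos S hS)]
  exact hd.noise T hT S hS hTS h

lemma wp_signal (hd : PosteriorDichotomy L n c A Y B Ng) (hl : LargeSample L n c A)
    (hS : S ∈ trees L) (hT : T ∈ trees L) (hST : S ∈ Ng T) (h : ¬ Disjoint (S \ T) B) :
    wp L n c Y S T = 1 := by
  rw [wp]
  refine max_eq_left ((min_le_left _ _).trans ?_)
  rw [postRatio, div_le_one (hd.post_pos S hS)]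
  nlinarith [hd.signal T hT S hST h, hl.one_le_cap, hd.post_pos T hT]

lemma infProp_of_grow (hm : InformedMoves L B Sstar Ng Np) (hS : S ∈ trees L) (hT : T ∈ Ng S) :
    infProp L n c A Y Ng Np S T = 1 / 2 * (wg L n c A Y S T / Zg L n c A Y Ng S) := by
  have h : T ∉ Np S := fun h =>
    (hm.grow S hS T hT).2.1.2 (hm.prune S hS T h).2.1.1
  simp [infProp, hT, h]

lemma infProp_of_prune (hm : InformedMoves L B Sstar Ng Np) (hS : S ∈ trees L) (hT : T ∈ Np S) :
    infProp L n c A Y Ng Np S T = 1 / 2 * (wp L n c Y S T / Zp L n c Y Np S) := by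
  have h : T ∉ Ng S := fun h =>
    (hm.grow S hS T h).2.1.2 (hm.prune S hS T hT).2.1.1
  simp [infProp, hT, h]

lemma Zg_nonneg (hm : InformedMoves L B Sstar Ng Np) (hd : PosteriorDichotomy L n c A Y B Ng)
    (hl : LargeSample L n c A) (hS : S ∈ trees L) : 0 ≤ Zg L n c A Y Ng S :=
  Finset.sum_nonneg fun T hT => (wg_pos hd hl hS (hm.grow S hS T hT).1).le

lemma Zp_nonneg : 0 ≤ Zp L n c Y Np S := Finset.sum_nonneg fun _ _ => wp_pos.le

lemma infProp_nonneg (hm : InformedMoves L B Sstar Ng Np)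
    (hd : PosteriorDichotomy L n c A Y B Ng) (hl : LargeSample L n c A) (hS : S ∈ trees L)
    (T : Finset ℕ) : 0 ≤ infProp L n c A Y Ng Np S T := by
  have h1 := Zg_nonneg hm hd hl hS
  have h2 : 0 ≤ Zp L n c Y Np S := Zp_nonneg
  refine add_nonneg (mul_nonneg (by norm_num) ?_) (mul_nonneg (by norm_num) ?_)
  · split_ifs with h
    · exact div_nonneg (wg_pos hd hl hS (hm.grow S hS T h).1).le h1
    · exact le_rfl
  · split_ifs with h
    · exact div_nonneg wp_pos.le h2
    · exact le_rfl

lemma infProp_sum_le (hm : InformedMoves L B Sstar Ng Np) (hS : S ∈ trees L) :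
    ∑ T ∈ trees L, infProp L n c A Y Ng Np S T ≤ 1 := by
  have hNg : (trees L).filter (· ∈ Ng S) = Ng S := by
    ext T; simp only [Finset.mem_filter, and_iff_right_iff_imp]
    exact fun h => (hm.grow S hS T h).1
  have hNp : (trees L).filter (· ∈ Np S) = Np S := by
    ext T; simp only [Finset.mem_filter, and_iff_right_iff_imp]
    exact fun h => (hm.prune S hS T h).1
  simp only [infProp, Finset.sum_add_distrib, ← Finset.mul_sum, ← Finset.sum_filter, hNg, hNp,
    ← Finset.sum_div]
  have h1 : (∑ T ∈ Ng S, wg L n c A Y S T) / Zg L n c A Y Ng S ≤ 1 := div_self_le_one _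
  have h2 : (∑ T ∈ Np S, wp L n c Y S T) / Zp L n c Y Np S ≤ 1 := div_self_le_one _
  linarith

lemma infProp_le_one (hm : InformedMoves L B Sstar Ng Np)
    (hd : PosteriorDichotomy L n c A Y B Ng) (hl : LargeSample L n c A) (hS : S ∈ trees L)
    (hT : T ∈ trees L) : infProp L n c A Y Ng Np S T ≤ 1 :=
  (Finset.single_le_sum (f := fun T => infProp L n c A Y Ng Np S T)
    (fun U _ => infProp_nonneg hm hd hl hS U) hT).trans (infProp_sum_le hm hS)

lemma infProp_grow_le_half (hm : InformedMoves L B Sstar Ng Np)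
    (hd : PosteriorDichotomy L n c A Y B Ng) (hl : LargeSample L n c A) (hS : S ∈ trees L)
    (hT : T ∈ Ng S) : infProp L n c A Y Ng Np S T ≤ 1 / 2 := by
  rw [infProp_of_grow hm hS hT]
  have h : wg L n c A Y S T / Zg L n c A Y Ng S ≤ 1 :=
    div_le_one_of_le₀ (Finset.single_le_sum (f := fun T => wg L n c A Y S T)
      (fun U hU => (wg_pos hd hl hS (hm.grow S hS U hU).1).le) hT) (Zg_nonneg hm hd hl hS)
  linarith

lemma infProp_prune_le_half (hm : InformedMoves L B Sstar Ng Np) (hS : S ∈ trees L)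
    (hT : T ∈ Np S) : infProp L n c A Y Ng Np S T ≤ 1 / 2 := by
  rw [infProp_of_prune hm hS hT]
  have h : wp L n c Y S T / Zp L n c Y Np S ≤ 1 :=
    div_le_one_of_le₀ (Finset.single_le_sum (f := fun T => wp L n c Y S T)
      (fun U _ => wp_pos.le) hT) Zp_nonneg
  linarith

/-- Transition matrix of the informed chain with neighborhoods `Ng` and `Np`. -/
def infP (L n : ℕ) (c A : ℝ) (Y : Fin n → ℝ) (Ng Np : Finset ℕ → Finset (Finset ℕ)) :
    Finset ℕ → Finset ℕ → ℝ :=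
  mhTrans L (post L n (splitP n c) Y) (infProp L n c A Y Ng Np)

/-- Growing a twig which contains a missing signal is always accepted. -/
lemma infP_grow_signal (hm : InformedMoves L B Sstar Ng Np)
    (hd : PosteriorDichotomy L n c A Y B Ng) (hl : LargeSample L n c A) (hS : S ∈ trees L)
    (hT : T ∈ Ng S) (h : ¬ Disjoint (T \ S) B) :
    infP L n c A Y Ng Np S T = infProp L n c A Y Ng Np S T := by
  obtain ⟨hTt, hST, -, hSp⟩ := hm.grow S hS T hT
  refine mhTrans_eq_prop hd.post_pos (fun S hS T _ => infProp_nonneg hm hd hl hS T) hS hTt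
    hST.ne' ?_
  have hZle : Zp L n c Y Np T ≤ (n : ℝ) ^ (A ^ 2 * Real.log n / 8) := by
    refine le_trans ?_ hl.cap_lower_noise
    have h1 : Zp L n c Y Np T ≤ (Np T).card • (n : ℝ) ^ (c - 3 / 2) :=
      Finset.sum_le_card_nsmul _ _ _ fun U _ => wp_le hl
    rw [nsmul_eq_mul] at h1
    refine h1.trans (mul_le_mul_of_nonneg_right ?_ (by linarith [hl.one_le_noise]))
    exact_mod_cast hm.prune_card T hTt
  have hZpos : 0 < Zp L n c Y Np T := Finset.sum_pos (fun _ _ => wp_pos) ⟨S, hSp⟩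
  have hq : 1 / 2 ≤ infProp L n c A Y Ng Np T S * (n : ℝ) ^ (A ^ 2 * Real.log n / 8) := by
    rw [infProp_of_prune hm hTt hSp, mul_assoc, div_mul_eq_mul_div (wp L n c Y T S)]
    have : 1 ≤ wp L n c Y T S * (n : ℝ) ^ (A ^ 2 * Real.log n / 8) / Zp L n c Y Np T := by
      rw [le_div_iff₀ hZpos, one_mul]
      have : 1 ≤ wp L n c Y T S := le_max_left _ _
      nlinarith
    linarith
  have hq0 := infProp_nonneg hm hd hl hTt S
  have hq2 := infProp_grow_le_half hm hd hl hS hT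
  have hπ := hd.post_pos S hS
  calc post L n (splitP n c) Y S * infProp L n c A Y Ng Np S T
      ≤ post L n (splitP n c) Y S *
        (infProp L n c A Y Ng Np T S * (n : ℝ) ^ (A ^ 2 * Real.log n / 8)) := by
        gcongr; linarith
    _ = infProp L n c A Y Ng Np T S *
        ((n : ℝ) ^ (A ^ 2 * Real.log n / 8) * post L n (splitP n c) Y S) := by ring
    _ ≤ infProp L n c A Y Ng Np T S * post L n (splitP n c) Y T := by
        gcongr; exact hd.signal S hS T hT h
    _ = _ := mul_comm _ _

/-- Once all signals are found, pruning a noise twig is always accepted. -/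
lemma infP_prune_noise (hm : InformedMoves L B Sstar Ng Np)
    (hd : PosteriorDichotomy L n c A Y B Ng) (hl : LargeSample L n c A) (hS : S ∈ trees L)
    (hT : T ∈ Np S) (hB : B ⊆ T) (h : Disjoint (S \ T) B) :
    infP L n c A Y Ng Np S T = infProp L n c A Y Ng Np S T := by
  obtain ⟨hTt, hTS, hSg⟩ := hm.prune S hS T hT
  refine mhTrans_eq_prop hd.post_pos (fun S hS T _ => infProp_nonneg hm hd hl hS T) hS hTt
    hTS.ne ?_
  have hnoise := hl.one_le_noise
  have hZle : Zg L n c A Y Ng T ≤ 1 := by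
    have h1 : Zg L n c A Y Ng T ≤ (Ng T).card • (1 / (n : ℝ) ^ (c - 3 / 2)) := by
      refine Finset.sum_le_card_nsmul _ _ _ fun U hU => (min_le_left _ _).trans ?_
      obtain ⟨hUt, hTU, -, -⟩ := hm.grow T hTt U hU
      refine postRatio_noise_le hd hl hTt hUt hTU ?_
      exact Finset.disjoint_left.mpr fun j hj hjB => (Finset.mem_sdiff.mp hj).2 (hB hjB)
    have h2 : ((Ng T).card : ℝ) ≤ 2 ^ L := by exact_mod_cast hm.grow_card T hTt
    refine h1.trans ?_
    rw [nsmul_eq_mul, mul_one_div, div_le_one (by linarith)]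
    exact h2.trans hl.two_pow_le
  have hZpos : 0 < Zg L n c A Y Ng T :=
    Finset.sum_pos (fun U hU => wg_pos hd hl hTt (hm.grow T hTt U hU).1) ⟨S, hSg⟩
  have hq := infProp_prune_le_half (n := n) (c := c) (A := A) (Y := Y) hm hS hT
  rw [infProp_of_grow hm hTt hSg, wg_noise hd hl hTt hS hTS h, postRatio]
  have hπ := hd.post_pos S hS
  have hπT := hd.post_pos T hTt
  have heq : post L n (splitP n c) Y T * (1 / 2 *
      (post L n (splitP n c) Y S / post L n (splitP n c) Y T / Zg L n c A Y Ng T))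
      = post L n (splitP n c) Y S * (1 / 2) / Zg L n c A Y Ng T := by
    field_simp
  rw [heq, le_div_iff₀ hZpos]
  have h0 := infProp_nonneg hm hd hl hS T
  nlinarith [mul_le_mul hq hZle hZpos.le (by norm_num : (0 : ℝ) ≤ 1 / 2)]

/-- Losing a signal is rarely accepted. -/
lemma infP_prune_signal_le (hm : InformedMoves L B Sstar Ng Np)
    (hd : PosteriorDichotomy L n c A Y B Ng) (hl : LargeSample L n c A) (hS : S ∈ trees L)
    (hT : T ∈ Np S) (h : ¬ Disjoint (S \ T) B) :
    infP L n c A Y Ng Np S T ≤ 1 / (n : ℝ) ^ (A ^ 2 * Real.log n / 8) := by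
  obtain ⟨hTt, hTS, hSg⟩ := hm.prune S hS T hT
  exact mhTrans_le_of_le hd.post_pos (fun S hS T _ => infProp_nonneg hm hd hl hS T) hS hTt
    hTS.ne (infProp_le_one hm hd hl hTt hS) (by linarith [hl.one_le_cap])
    (hd.signal T hTt S hSg h)

/-- Growing a noise twig is rarely accepted. -/
lemma infP_grow_noise_le (hm : InformedMoves L B Sstar Ng Np)
    (hd : PosteriorDichotomy L n c A Y B Ng) (hl : LargeSample L n c A) (hS : S ∈ trees L)
    (hT : T ∈ Ng S) (h : Disjoint (T \ S) B) :
    infP L n c A Y Ng Np S T ≤ 1 / (n : ℝ) ^ (c - 3 / 2) := by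
  obtain ⟨hTt, hST, -, -⟩ := hm.grow S hS T hT
  exact mhTrans_le_of_le hd.post_pos (fun S hS T _ => infProp_nonneg hm hd hl hS T) hS hTt
    hST.ne' (infProp_le_one hm hd hl hTt hS) (by linarith [hl.one_le_noise])
    (hd.noise S hS T hTt hST h)

lemma infP_nonneg (hm : InformedMoves L B Sstar Ng Np)
    (hd : PosteriorDichotomy L n c A Y B Ng) (hl : LargeSample L n c A) (hS : S ∈ trees L)
    (hT : T ∈ trees L) : 0 ≤ infP L n c A Y Ng Np S T :=
  mhTrans_nonneg hd.post_pos (fun _ hS T _ => infProp_nonneg hm hd hl hS T)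
    (fun _ hS => infProp_sum_le hm hS) hS hT

/-- The one-step change of a function splits into GROW and PRUNE contributions. -/
lemma infP_apply (hm : InformedMoves L B Sstar Ng Np) (hS : S ∈ trees L) (f : Finset ℕ → ℝ) :
    ∑ T ∈ trees L, infP L n c A Y Ng Np S T * f T = f S +
      ∑ T ∈ Ng S, infP L n c A Y Ng Np S T * (f T - f S) +
      ∑ T ∈ Np S, infP L n c A Y Ng Np S T * (f T - f S) := by
  have h1 : ∑ T ∈ trees L, infP L n c A Y Ng Np S T * f T
      = f S + ∑ T ∈ trees L, infP L n c A Y Ng Np S T * (f T - f S) := by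
    simp only [mul_sub, Finset.sum_sub_distrib, ← Finset.sum_mul]
    rw [show ∑ T ∈ trees L, infP L n c A Y Ng Np S T = 1 from mhTrans_sum hS]
    ring
  have hdis : Disjoint (Ng S) (Np S) := Finset.disjoint_left.mpr fun T hg hp =>
    (hm.grow S hS T hg).2.1.2 (hm.prune S hS T hp).2.1.1
  rw [h1, add_assoc, ← Finset.sum_union hdis]
  congr 1
  refine (Finset.sum_subset ?_ ?_).symm
  · exact Finset.union_subset (fun T hT => (hm.grow S hS T hT).1)
      fun T hT => (hm.prune S hS T hT).1
  · intro T _ hT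
    rw [Finset.mem_union, not_or] at hT
    by_cases h : T = S
    · simp [h]
    · have : infProp L n c A Y Ng Np S T = 0 := by simp [infProp, hT]
      rw [infP, mhTrans_of_ne h, this]
      simp

end Informed

section InformedDrift

variable {L n : ℕ} {c A : ℝ} {Y : Fin n → ℝ} {B Sstar : Finset ℕ}
  {Ng Np : Finset ℕ → Finset (Finset ℕ)} {S T : Finset ℕ}

lemma signal_grow_mass (hm : InformedMoves L B Sstar Ng Np)
    (hd : PosteriorDichotomy L n c A Y B Ng) (hl : LargeSample L n c A) (hS : S ∈ trees L)
    (hB : ¬ B ⊆ S) :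
    1 / 4 ≤ ∑ T ∈ (Ng S).filter (fun T => ¬ Disjoint (T \ S) B), infP L n c A Y Ng Np S T := by
  obtain ⟨T₀, hT₀, hT₀B⟩ := hm.exists_grow S hS hB
  have hw : ∀ T ∈ Ng S, 0 < wg L n c A Y S T := fun T hT => wg_pos hd hl hS (hm.grow S hS T hT).1
  refine (quarter_le_sum_filter (w := wg L n c A Y S) (N := Ng S)
    (G := fun T => ¬ Disjoint (T \ S) B) (Finset.sum_pos hw ⟨T₀, hT₀⟩) ?_).trans (le_of_eq ?_)
  · have h1 : ∑ T ∈ (Ng S).filter (fun T => ¬ ¬ Disjoint (T \ S) B), wg L n c A Y S T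
        ≤ ((Ng S).filter (fun T => ¬ ¬ Disjoint (T \ S) B)).card •
          (1 / (n : ℝ) ^ (c - 3 / 2)) := by
      refine Finset.sum_le_card_nsmul _ _ _ fun T hT => ?_
      rw [Finset.mem_filter, not_not] at hT
      obtain ⟨hTt, hST, -, -⟩ := hm.grow S hS T hT.1
      exact (min_le_left _ _).trans (postRatio_noise_le hd hl hS hTt hST hT.2)
    have h2 : (((Ng S).filter (fun T => ¬ ¬ Disjoint (T \ S) B)).card : ℝ) ≤ 2 ^ L := by
      exact_mod_cast (Finset.card_filter_le _ _).trans (hm.grow_card S hS)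
    have h3 : wg L n c A Y S T₀ ≤
        ∑ T ∈ (Ng S).filter (fun T => ¬ Disjoint (T \ S) B), wg L n c A Y S T :=
      Finset.single_le_sum (f := fun T => wg L n c A Y S T)
        (fun T hT => (hw T (Finset.mem_filter.mp hT).1).le)
        (Finset.mem_filter.mpr ⟨hT₀, hT₀B⟩)
    rw [wg_signal hd hS hT₀ hT₀B] at h3
    have h4 : ((Ng S).filter (fun T => ¬ ¬ Disjoint (T \ S) B)).card •
          (1 / (n : ℝ) ^ (c - 3 / 2)) ≤ 1 := by
      rw [nsmul_eq_mul, mul_one_div, div_le_one (by linarith [hl.one_le_noise])]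
      exact h2.trans hl.two_pow_le
    linarith [hl.one_le_cap]
  · refine Finset.sum_congr rfl fun T hT => ?_
    rw [Finset.mem_filter] at hT
    rw [infP_grow_signal hm hd hl hS hT.1 hT.2, infProp_of_grow hm hS hT.1, Zg]

lemma noise_prune_mass (hm : InformedMoves L B Sstar Ng Np)
    (hd : PosteriorDichotomy L n c A Y B Ng) (hl : LargeSample L n c A) (hS : S ∈ trees L)
    (hB : B ⊆ S) (hne : S ≠ Sstar) :
    1 / 4 ≤ ∑ T ∈ (Np S).filter (fun T => Disjoint (S \ T) B), infP L n c A Y Ng Np S T := by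
  obtain ⟨T₀, hT₀, hT₀B⟩ := hm.exists_prune S hS hB hne
  refine (quarter_le_sum_filter (w := wp L n c Y S) (N := Np S)
    (G := fun T => Disjoint (S \ T) B) (Finset.sum_pos (fun _ _ => wp_pos) ⟨T₀, hT₀⟩)
    ?_).trans (le_of_eq ?_)
  · have h1 : ∑ T ∈ (Np S).filter (fun T => ¬ Disjoint (S \ T) B), wp L n c Y S T
        ≤ ((Np S).filter (fun T => ¬ Disjoint (S \ T) B)).card • (1 : ℝ) := by
      refine Finset.sum_le_card_nsmul _ _ _ fun T hT => ?_
      rw [Finset.mem_filter] at hT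
      obtain ⟨hTt, hTS, hSg⟩ := hm.prune S hS T hT.1
      exact (wp_signal hd hl hS hTt hSg hT.2).le
    have h2 : (((Np S).filter (fun T => ¬ Disjoint (S \ T) B)).card : ℝ) ≤ 2 ^ L := by
      exact_mod_cast (Finset.card_filter_le _ _).trans (hm.prune_card S hS)
    have h3 : wp L n c Y S T₀ ≤
        ∑ T ∈ (Np S).filter (fun T => Disjoint (S \ T) B), wp L n c Y S T :=
      Finset.single_le_sum (f := fun T => wp L n c Y S T) (fun _ _ => wp_pos.le)
        (Finset.mem_filter.mpr ⟨hT₀, hT₀B⟩)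
    obtain ⟨hTt, hTS, -⟩ := hm.prune S hS T₀ hT₀
    rw [wp_noise hd hl hS hTt hTS hT₀B] at h3
    rw [nsmul_eq_mul, mul_one] at h1
    linarith [hl.two_pow_le]
  · refine Finset.sum_congr rfl fun T hT => ?_
    rw [Finset.mem_filter] at hT
    rw [infP_prune_noise hm hd hl hS hT.1 (subset_of_disjoint_sdiff hT.2 hB) hT.2,
      infProp_of_prune hm hS hT.1, Zp]

lemma signal_prune_change_le (hB : B ⊆ Sstar) (hstar : Sstar ∈ trees L)
    (hm : InformedMoves L B Sstar Ng Np)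
    (hd : PosteriorDichotomy L n c A Y B Ng) (hl : LargeSample L n c A) (hS : S ∈ trees L) :
    ∑ T ∈ (Np S).filter (fun T => ¬ Disjoint (S \ T) B),
      infP L n c A Y Ng Np S T * (driftF L B Sstar T - driftF L B Sstar S) ≤ 1 / 128 := by
  have hcap := hl.one_le_cap
  have h1 : ∑ T ∈ (Np S).filter (fun T => ¬ Disjoint (S \ T) B),
      infP L n c A Y Ng Np S T * (driftF L B Sstar T - driftF L B Sstar S) ≤
      ((Np S).filter (fun T => ¬ Disjoint (S \ T) B)).card •
        (1 / (n : ℝ) ^ (A ^ 2 * Real.log n / 8) * 2 ^ (L + 1)) := by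
    refine Finset.sum_le_card_nsmul _ _ _ fun T hT => ?_
    rw [Finset.mem_filter] at hT
    have hTt := (hm.prune S hS T hT.1).1
    have h2 := infP_prune_signal_le hm hd hl hS hT.1 hT.2
    have h3 := infP_nonneg hm hd hl hS hTt
    have h4 : driftF L B Sstar T - driftF L B Sstar S ≤ 2 ^ (L + 1) := by
      linarith [driftF_le hB hstar hTt, driftF_nonneg (L := L) (B := B) (Sstar := Sstar) (S := S)]
    exact (mul_le_mul_of_nonneg_left h4 h3).trans
      (mul_le_mul_of_nonneg_right h2 (by positivity))
  have h5 : (((Np S).filter (fun T => ¬ Disjoint (S \ T) B)).card : ℝ) ≤ 2 ^ L := by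
    exact_mod_cast (Finset.card_filter_le _ _).trans (hm.prune_card S hS)
  refine h1.trans ?_
  rw [nsmul_eq_mul]
  calc _ ≤ 2 ^ L * (1 / (n : ℝ) ^ (A ^ 2 * Real.log n / 8) * 2 ^ (L + 1)) := by gcongr
    _ = 2 ^ L * 2 ^ (L + 1) / (n : ℝ) ^ (A ^ 2 * Real.log n / 8) := by ring
    _ ≤ 1 / 128 := by
      rw [div_le_div_iff₀ (by linarith) (by norm_num)]
      linarith [hl.cap_lower]

lemma drift_of_missing_signal (hB : B ⊆ Sstar) (hstar : Sstar ∈ trees L)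
    (hm : InformedMoves L B Sstar Ng Np)
    (hd : PosteriorDichotomy L n c A Y B Ng) (hl : LargeSample L n c A) (hS : S ∈ trees L)
    (hBS : ¬ B ⊆ S) :
    ∑ T ∈ trees L, infP L n c A Y Ng Np S T * driftF L B Sstar T ≤
      driftF L B Sstar S - 15 / 64 := by
  rw [infP_apply hm hS]
  have hgrow : ∑ T ∈ Ng S,
      infP L n c A Y Ng Np S T * (driftF L B Sstar T - driftF L B Sstar S) ≤ -(1 / 4) := by
    rw [← Finset.sum_filter_not_add_sum_filter _ (fun T => Disjoint (T \ S) B)]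
    have h0 : ∑ T ∈ (Ng S).filter (fun T => Disjoint (T \ S) B),
        infP L n c A Y Ng Np S T * (driftF L B Sstar T - driftF L B Sstar S) = 0 := by
      refine Finset.sum_eq_zero fun T hT => ?_
      rw [Finset.mem_filter] at hT
      rw [driftF_eq_of_disjoint (hm.grow S hS T hT.1).2.1.1 hBS hT.2, sub_self, mul_zero]
    have h1 : ∑ T ∈ (Ng S).filter (fun T => ¬ Disjoint (T \ S) B),
        infP L n c A Y Ng Np S T * (driftF L B Sstar T - driftF L B Sstar S) ≤
        ∑ T ∈ (Ng S).filter (fun T => ¬ Disjoint (T \ S) B), -infP L n c A Y Ng Np S T := by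
      refine Finset.sum_le_sum fun T hT => ?_
      rw [Finset.mem_filter] at hT
      obtain ⟨hTt, hST, -, -⟩ := hm.grow S hS T hT.1
      have h2 := driftF_grow_signal (Sstar := Sstar) hTt hST hBS hT.2
      nlinarith [infP_nonneg hm hd hl hS hTt]
    rw [Finset.sum_neg_distrib] at h1
    linarith [signal_grow_mass hm hd hl hS hBS]
  have hprune : ∑ T ∈ Np S,
      infP L n c A Y Ng Np S T * (driftF L B Sstar T - driftF L B Sstar S) ≤ 1 / 128 := by
    rw [← Finset.sum_filter_not_add_sum_filter _ (fun T => Disjoint (S \ T) B)]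
    have h0 : ∑ T ∈ (Np S).filter (fun T => Disjoint (S \ T) B),
        infP L n c A Y Ng Np S T * (driftF L B Sstar T - driftF L B Sstar S) = 0 := by
      refine Finset.sum_eq_zero fun T hT => ?_
      rw [Finset.mem_filter] at hT
      have hTS := (hm.prune S hS T hT.1).2.1.1
      rw [driftF_eq_of_disjoint hTS (fun h => hBS (h.trans hTS)) hT.2, sub_self, mul_zero]
    linarith [signal_prune_change_le hB hstar hm hd hl hS]
  linarith

lemma drift_of_all_signals (hB : B ⊆ Sstar) (hstar : Sstar ∈ trees L)
    (hm : InformedMoves L B Sstar Ng Np)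
    (hmin : ∀ T ∈ trees L, B ⊆ T → Sstar ⊆ T)
    (hd : PosteriorDichotomy L n c A Y B Ng) (hl : LargeSample L n c A) (hS : S ∈ trees L)
    (hBS : B ⊆ S) :
    ∑ T ∈ trees L, infP L n c A Y Ng Np S T * driftF L B Sstar T ≤
      driftF L B Sstar S - 15 / 64 + if S = Sstar then 1 / 4 else 0 := by
  rw [infP_apply hm hS]
  have hnoise := hl.one_le_noise
  have hgrow : ∑ T ∈ Ng S,
      infP L n c A Y Ng Np S T * (driftF L B Sstar T - driftF L B Sstar S) ≤ 1 / 128 := by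
    have h1 : ∑ T ∈ Ng S,
        infP L n c A Y Ng Np S T * (driftF L B Sstar T - driftF L B Sstar S) ≤
        (Ng S).card • (1 / (n : ℝ) ^ (c - 3 / 2) * ((L : ℝ) + 1)) := by
      refine Finset.sum_le_card_nsmul _ _ _ fun T hT => ?_
      obtain ⟨hTt, hST, hcard, -⟩ := hm.grow S hS T hT
      have hdis : Disjoint (T \ S) B :=
        Finset.disjoint_left.mpr fun j hj hjB => (Finset.mem_sdiff.mp hj).2 (hBS hjB)
      have h2 := infP_grow_noise_le hm hd hl hS hT hdis
      exact (mul_le_mul_of_nonneg_left (driftF_grow_noise hBS hST.1 hcard)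
        (infP_nonneg hm hd hl hS hTt)).trans (mul_le_mul_of_nonneg_right h2 (by positivity))
    have h5 : ((Ng S).card : ℝ) ≤ 2 ^ L := by exact_mod_cast hm.grow_card S hS
    refine h1.trans ?_
    rw [nsmul_eq_mul]
    calc _ ≤ 2 ^ L * (1 / (n : ℝ) ^ (c - 3 / 2) * ((L : ℝ) + 1)) := by gcongr
      _ = 2 ^ L * ((L : ℝ) + 1) / (n : ℝ) ^ (c - 3 / 2) := by ring
      _ ≤ 1 / 128 := by
        rw [div_le_div_iff₀ (by linarith) (by norm_num)]
        linarith [hl.noise_lower]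
  have hprune : ∑ T ∈ (Np S).filter (fun T => Disjoint (S \ T) B),
      infP L n c A Y Ng Np S T * (driftF L B Sstar T - driftF L B Sstar S) ≤
      -∑ T ∈ (Np S).filter (fun T => Disjoint (S \ T) B), infP L n c A Y Ng Np S T := by
    rw [← Finset.sum_neg_distrib]
    refine Finset.sum_le_sum fun T hT => ?_
    rw [Finset.mem_filter] at hT
    obtain ⟨hTt, hTS, -⟩ := hm.prune S hS T hT.1
    have hBT := subset_of_disjoint_sdiff hT.2 hBS
    have h2 := driftF_prune_noise (L := L) hBT (hmin T hTt hBT) hTS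
    nlinarith [infP_nonneg hm hd hl hS hTt]
  have hmass : (if S = Sstar then (0 : ℝ) else 1 / 4) ≤
      ∑ T ∈ (Np S).filter (fun T => Disjoint (S \ T) B), infP L n c A Y Ng Np S T := by
    split_ifs with h
    · exact Finset.sum_nonneg fun T hT =>
        infP_nonneg hm hd hl hS (hm.prune S hS T (Finset.mem_filter.mp hT).1).1
    · exact noise_prune_mass hm hd hl hS hBS h
  rw [← Finset.sum_filter_not_add_sum_filter (Np S) (fun T => Disjoint (S \ T) B)]
  have hsig := signal_prune_change_le hB hstar hm hd hl hS
  split_ifs at hmass ⊢ <;> linarith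

end InformedDrift

/-- Linear mixing of an informed chain on the event where the posterior separates signals
from noise. -/
theorem infP_mixTime_le {L n : ℕ} {c A : ℝ} {Y : Fin n → ℝ} {B Sstar : Finset ℕ}
    {Ng Np : Finset ℕ → Finset (Finset ℕ)} (hB : B ⊆ Sstar) (hstar : Sstar ∈ trees L)
    (hmin : ∀ T ∈ trees L, B ⊆ T → Sstar ⊆ T) (hm : InformedMoves L B Sstar Ng Np)
    (hd : PosteriorDichotomy L n c A Y B Ng) (hl : LargeSample L n c A)
    {δ : ℝ} (hδ : δ ∈ Set.Ioo (0 : ℝ) 1) :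
    (mixTime L n (splitP n c) Y (infP L n c A Y Ng Np) δ : ℝ) ≤
      6 * Real.log (6 / δ) * 2 ^ (L + 5) := by
  have hq : ∀ S ∈ trees L, ∀ T ∈ trees L, 0 ≤ infProp L n c A Y Ng Np S T :=
    fun S hS T _ => infProp_nonneg hm hd hl hS T
  have hsum : ∑ S ∈ trees L, post L n (splitP n c) Y S = 1 := by
    have h := hd.post_pos Sstar hstar
    unfold post at h ⊢
    rw [← Finset.sum_div]
    refine div_self fun h0 => ?_
    simp [h0] at h
  refine mixTime_le_of_drift (fun S hS T hT => infP_nonneg hm hd hl hS hT)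
    (fun S hS => mhTrans_sum hS) (fun S hS => (hd.post_pos S hS).le) hsum
    (fun T hT => mhTrans_stationary hd.post_pos hq hT) hstar
    (f := driftF L B Sstar) (fun S _ => driftF_nonneg) (fun S hS => driftF_le hB hstar hS)
    (fun S hS => ?_) hδ
  by_cases hBS : B ⊆ S
  · exact drift_of_all_signals hB hstar hm hmin hd hl hS hBS
  · have h := drift_of_missing_signal hB hstar hm hd hl hS hBS
    have hne : S ≠ Sstar := fun h => hBS (h ▸ hB)
    rw [if_neg hne]
    linarith

/-! ## Combinatorics of the moves -/

section Combinatorics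

variable {L : ℕ} {S T : Finset ℕ} {a b i j : ℕ}

lemma mem_trees_iff : S ∈ trees L ↔
    0 ∈ S ∧ (∀ j ∈ S, 1 ≤ j → j / 2 ∈ S) ∧ ∀ j ∈ S, j < 2 ^ L := by
  simp only [trees, Finset.mem_filter, Finset.mem_powerset, IsTree, and_iff_right_iff_imp]
  exact fun h j hj => Finset.mem_range.mpr (h.2.2 j hj)

lemma mem_extSet_iff : j ∈ extSet S ↔ j / 2 ∈ S ∧ j ∉ S := by
  simp only [extSet, Finset.mem_filter, Finset.mem_union, Finset.mem_image]
  refine and_congr_left fun _ => ⟨?_, fun h => ?_⟩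
  · rintro (⟨i, hi, rfl⟩ | ⟨i, hi, rfl⟩)
    · rwa [show 2 * i / 2 = i by omega]
    · rwa [show (2 * i + 1) / 2 = i by omega]
  · rcases Nat.mod_two_eq_zero_or_one j with h2 | h2
    · exact Or.inl ⟨j / 2, h, by omega⟩
    · exact Or.inr ⟨j / 2, h, by omega⟩

/-- A tree has as many external as internal nodes. -/
lemma card_extSet (hS : S ∈ trees L) : (extSet S).card = S.card := by
  obtain ⟨h0, hpar, -⟩ := mem_trees_iff.mp hS
  set U := (S.image fun j => 2 * j) ∪ S.image fun j => 2 * j + 1 with hU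
  have hUcard : U.card = 2 * S.card := by
    rw [hU, Finset.card_union_of_disjoint, Finset.card_image_of_injective,
      Finset.card_image_of_injective, two_mul]
    · intro x y h; simp only at h; omega
    · intro x y h; simp only at h; omega
    · rw [Finset.disjoint_left]
      intro x hx hy
      obtain ⟨y, -, rfl⟩ := Finset.mem_image.mp hx
      obtain ⟨z, -, hz⟩ := Finset.mem_image.mp hy
      omega
  have hsub : S ⊆ U := by
    intro j hj
    have hj2 : j / 2 ∈ S := by
      rcases Nat.eq_zero_or_pos j with h | h
      · rw [h]; exact h0
      · exact hpar j hj h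
    simp only [hU, Finset.mem_union, Finset.mem_image]
    rcases Nat.mod_two_eq_zero_or_one j with h2 | h2
    · exact Or.inl ⟨j / 2, hj2, by omega⟩
    · exact Or.inr ⟨j / 2, hj2, by omega⟩
  have : extSet S = U \ S := by rw [Finset.sdiff_eq_filter]; rfl
  rw [this, Finset.card_sdiff_of_subset hsub, hUcard]
  omega

lemma sdiff_nonempty_of_ne (hsub : T ⊆ S) (hne : S ≠ T) : (S \ T).Nonempty := by
  rw [Finset.sdiff_nonempty]
  exact fun h => hne (h.antisymm hsub)

lemma card_image_le_two_pow {N : Finset ℕ} (f : ℕ → Finset ℕ) (h : ∀ j ∈ N, j < 2 ^ L) :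
    (N.image f).card ≤ 2 ^ L := by
  refine Finset.card_image_le.trans ?_
  rw [← Finset.card_range (2 ^ L)]
  exact Finset.card_le_card fun j hj => Finset.mem_range.mpr (h j hj)

lemma mem_bNg_iff : T ∈ bNg L S ↔ ∃ j, j / 2 ∈ S ∧ j ∉ S ∧ j < 2 ^ L ∧ insert j S = T := by
  simp only [bNg, growCands, Finset.mem_image, Finset.mem_filter, mem_extSet_iff, and_assoc]

lemma mem_bNp_iff : T ∈ bNp S ↔
    ∃ j, j ∈ S ∧ j ≠ 0 ∧ 2 * j ∉ S ∧ 2 * j + 1 ∉ S ∧ S.erase j = T := by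
  simp only [bNp, pruneCands, Finset.mem_image, Finset.mem_filter, and_assoc]

/-- When the signal set is itself a tree, one-node moves reach it. -/
theorem informedMoves_bcart (hstar : T ∈ trees L) :
    InformedMoves L T T (bNg L) bNp where
  grow S hS U hU := by
    obtain ⟨h0, hpar, hlt⟩ := mem_trees_iff.mp hS
    obtain ⟨j, hj2, hjS, hjL, rfl⟩ := mem_bNg_iff.mp hU
    have hj0 : j ≠ 0 := fun h => hjS (h ▸ h0)
    refine ⟨mem_trees_iff.mpr ⟨?_, ?_, ?_⟩, Finset.ssubset_insert hjS, ?_,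
      mem_bNp_iff.mpr ⟨j, Finset.mem_insert_self _ _, hj0, ?_, ?_, Finset.erase_insert hjS⟩⟩
    · exact Finset.mem_insert_of_mem h0
    · intro i hi hi1
      rcases Finset.mem_insert.mp hi with rfl | hi
      · exact Finset.mem_insert_of_mem hj2
      · exact Finset.mem_insert_of_mem (hpar i hi hi1)
    · intro i hi
      rcases Finset.mem_insert.mp hi with rfl | hi
      · exact hjL
      · exact hlt i hi
    · rw [Finset.insert_sdiff_cancel hjS, Finset.card_singleton]
      omega
    · rw [Finset.mem_insert, not_or]
      refine ⟨by omega, fun h => hjS ?_⟩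
      have := hpar _ h (by omega)
      rwa [show 2 * j / 2 = j by omega] at this
    · rw [Finset.mem_insert, not_or]
      refine ⟨by omega, fun h => hjS ?_⟩
      have := hpar _ h (by omega)
      rwa [show (2 * j + 1) / 2 = j by omega] at this
  prune S hS U hU := by
    obtain ⟨h0, hpar, hlt⟩ := mem_trees_iff.mp hS
    obtain ⟨j, hjS, hj0, hj1, hj2, rfl⟩ := mem_bNp_iff.mp hU
    refine ⟨mem_trees_iff.mpr ⟨?_, ?_, ?_⟩, Finset.erase_ssubset hjS,
      mem_bNg_iff.mpr ⟨j, ?_, Finset.notMem_erase _ _, hlt j hjS, Finset.insert_erase hjS⟩⟩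
    · exact Finset.mem_erase.mpr ⟨hj0.symm, h0⟩
    · intro i hi hi1
      obtain ⟨-, hiS⟩ := Finset.mem_erase.mp hi
      refine Finset.mem_erase.mpr ⟨fun h => ?_, hpar i hiS hi1⟩
      rcases Nat.mod_two_eq_zero_or_one i with h2 | h2
      · exact hj1 (by rwa [show 2 * j = i by omega])
      · exact hj2 (by rwa [show 2 * j + 1 = i by omega])
    · exact fun i hi => hlt i (Finset.mem_of_mem_erase hi)
    · exact Finset.mem_erase.mpr ⟨by omega, hpar j hjS (by omega)⟩
  grow_card S _ := by
    refine card_image_le_two_pow _ fun j hj => ?_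
    exact (Finset.mem_filter.mp hj).2
  prune_card S hS := by
    refine card_image_le_two_pow _ fun j hj => ?_
    exact (mem_trees_iff.mp hS).2.2 j (Finset.mem_filter.mp hj).1
  exists_grow S hS hT := by
    obtain ⟨h0, -, -⟩ := mem_trees_iff.mp hS
    obtain ⟨-, hTpar, hTlt⟩ := mem_trees_iff.mp hstar
    have hne : (T \ S).Nonempty := Finset.sdiff_nonempty.mpr hT
    set j := (T \ S).min' hne with hj
    have hjm : j ∈ T \ S := Finset.min'_mem _ hne
    obtain ⟨hjT, hjS⟩ := Finset.mem_sdiff.mp hjm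
    have hj0 : j ≠ 0 := fun h => hjS (h ▸ h0)
    have hj2 : j / 2 ∈ S := by
      by_contra h
      have := Finset.min'_le (T \ S) (j / 2)
        (Finset.mem_sdiff.mpr ⟨hTpar j hjT (by omega), h⟩)
      omega
    refine ⟨insert j S, mem_bNg_iff.mpr ⟨j, hj2, hjS, hTlt j hjT, rfl⟩, ?_⟩
    rw [Finset.insert_sdiff_cancel hjS, Finset.disjoint_singleton_left, not_not]
    exact hjT
  exists_prune S hS hTS hne := by
    obtain ⟨-, hpar, -⟩ := mem_trees_iff.mp hS
    obtain ⟨hT0, hTpar, -⟩ := mem_trees_iff.mp hstar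
    have hne' := sdiff_nonempty_of_ne hTS hne
    set j := (S \ T).max' hne' with hj
    obtain ⟨hjS, hjT⟩ := Finset.mem_sdiff.mp (Finset.max'_mem _ hne')
    have hj0 : j ≠ 0 := fun h => hjT (by rw [← hj, h]; exact hT0)
    have hchild : ∀ i, i / 2 = j → 1 ≤ i → i ∉ S := by
      intro i hi hi1 hiS
      by_cases hiT : i ∈ T
      · exact hjT (by rw [← hj, ← hi]; exact hTpar i hiT hi1)
      · have := Finset.le_max' (S \ T) i (Finset.mem_sdiff.mpr ⟨hiS, hiT⟩)
        omega
    refine ⟨S.erase j, mem_bNp_iff.mpr ⟨j, hjS, hj0, hchild _ (by omega) (by omega),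
      hchild _ (by omega) (by omega), rfl⟩, ?_⟩
    rw [Finset.sdiff_erase_self hjS, Finset.disjoint_singleton_left]
    exact hjT

lemma mem_ancPath_iff : i ∈ ancPath j ↔ ∃ t, j / 2 ^ t = i := by
  simp only [ancPath, Finset.mem_image, Finset.mem_range]
  refine ⟨fun ⟨t, _, h⟩ => ⟨t, h⟩, fun ⟨t, h⟩ => ?_⟩
  by_cases ht : t < j + 1
  · exact ⟨t, ht, h⟩
  · refine ⟨j, by omega, ?_⟩
    rw [← h, Nat.div_eq_of_lt Nat.lt_two_pow_self,
      Nat.div_eq_of_lt (Nat.lt_two_pow_self.trans_le (Nat.pow_le_pow_right (by norm_num) (by omega)))]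

lemma isAnc_iff : isAnc a b ↔ 1 ≤ b ∧ ∃ t, b / 2 ^ (t + 1) = a := by
  simp only [isAnc, Finset.mem_Icc]
  constructor
  · rintro ⟨t, ⟨h1, h2⟩, h⟩
    exact ⟨h1.trans h2, t - 1, by rwa [Nat.sub_add_cancel h1]⟩
  · rintro ⟨hb, t, h⟩
    by_cases ht : t + 1 ≤ b
    · exact ⟨t + 1, ⟨by omega, ht⟩, h⟩
    · refine ⟨b, ⟨hb, le_rfl⟩, ?_⟩
      rw [← h, Nat.div_eq_of_lt Nat.lt_two_pow_self, Nat.div_eq_of_lt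
        (Nat.lt_two_pow_self.trans_le (Nat.pow_le_pow_right (by norm_num) (by omega)))]

lemma isAnc.lt (h : isAnc a b) : a < b := by
  obtain ⟨hb, t, rfl⟩ := isAnc_iff.mp h
  exact Nat.div_lt_self hb (Nat.one_lt_pow (by omega) (by norm_num))

lemma isAnc.mem_ancPath (h : isAnc a b) : a ∈ ancPath b := by
  obtain ⟨-, t, ht⟩ := isAnc_iff.mp h
  exact mem_ancPath_iff.mpr ⟨t + 1, ht⟩

lemma self_mem_ancPath : j ∈ ancPath j := mem_ancPath_iff.mpr ⟨0, by simp⟩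

lemma isAnc_half (hj : 1 ≤ j) : isAnc (j / 2) j := isAnc_iff.mpr ⟨hj, 0, by simp⟩

lemma isAnc_of_half (hj : 1 ≤ j) (h : isAnc a (j / 2)) : isAnc a j := by
  obtain ⟨-, t, ht⟩ := isAnc_iff.mp h
  refine isAnc_iff.mpr ⟨hj, t + 1, ?_⟩
  rw [← ht, Nat.div_div_eq_div_mul, pow_succ' 2 (t + 1)]

lemma ancPath_subset (hS : S ∈ trees L) (hj : j ∈ S) : ancPath j ⊆ S := by
  obtain ⟨h0, hpar, -⟩ := mem_trees_iff.mp hS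
  intro i hi
  obtain ⟨t, rfl⟩ := mem_ancPath_iff.mp hi
  clear hi
  induction t with
  | zero => simpa using hj
  | succ t ih =>
    rw [pow_succ, ← Nat.div_div_eq_div_mul]
    rcases Nat.eq_zero_or_pos (j / 2 ^ t) with h | h
    · rw [h]; exact h0
    · exact hpar _ ih h

lemma isAnc.mem_tree (h : isAnc a b) (hS : S ∈ trees L) (hb : b ∈ S) : a ∈ S :=
  ancPath_subset hS hb h.mem_ancPath

/-- Nonzero nodes of an ancestral path are comparable. -/
lemma ancPath_comparable (ha : a ∈ ancPath j) (hb : b ∈ ancPath j) (ha0 : a ≠ 0) (hb0 : b ≠ 0) :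
    a = b ∨ isAnc a b ∨ isAnc b a := by
  obtain ⟨s, rfl⟩ := mem_ancPath_iff.mp ha
  obtain ⟨t, rfl⟩ := mem_ancPath_iff.mp hb
  rcases lt_trichotomy s t with h | h | h
  · refine Or.inr (Or.inr (isAnc_iff.mpr ⟨Nat.one_le_iff_ne_zero.mpr ha0, t - s - 1, ?_⟩))
    rw [Nat.div_div_eq_div_mul, ← pow_add]
    congr 2; omega
  · exact Or.inl (by rw [h])
  · refine Or.inr (Or.inl (isAnc_iff.mpr ⟨Nat.one_le_iff_ne_zero.mpr hb0, s - t - 1, ?_⟩))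
    rw [Nat.div_div_eq_div_mul, ← pow_add]
    congr 2; omega

lemma card_ancPath_le (hj : j < 2 ^ L) : (ancPath j).card ≤ L + 1 := by
  have hsub : ancPath j ⊆ (Finset.range (L + 1)).image fun t => j / 2 ^ t := by
    intro i hi
    obtain ⟨t, rfl⟩ := mem_ancPath_iff.mp hi
    rw [Finset.mem_image]
    by_cases ht : t < L + 1
    · exact ⟨t, Finset.mem_range.mpr ht, rfl⟩
    · refine ⟨L, Finset.mem_range.mpr (by omega), ?_⟩
      rw [Nat.div_eq_of_lt hj,
        Nat.div_eq_of_lt (hj.trans_le (Nat.pow_le_pow_right (by norm_num) (by omega)))]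
  refine (Finset.card_le_card hsub).trans (Finset.card_image_le.trans ?_)
  rw [Finset.card_range]

lemma growTwig_mem_trees (hS : S ∈ trees L) (hj : j < 2 ^ L) : growTwig S j ∈ trees L := by
  obtain ⟨h0, hpar, hlt⟩ := mem_trees_iff.mp hS
  refine mem_trees_iff.mpr ⟨Finset.mem_union_left _ h0, fun i hi hi1 => ?_, fun i hi => ?_⟩
  · rcases Finset.mem_union.mp hi with hi | hi
    · exact Finset.mem_union_left _ (hpar i hi hi1)
    · obtain ⟨t, rfl⟩ := mem_ancPath_iff.mp hi
      refine Finset.mem_union_right _ (mem_ancPath_iff.mpr ⟨t + 1, ?_⟩)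
      rw [pow_succ, Nat.div_div_eq_div_mul]
  · rcases Finset.mem_union.mp hi with hi | hi
    · exact hlt i hi
    · obtain ⟨t, rfl⟩ := mem_ancPath_iff.mp hi
      exact (Nat.div_le_self _ _).trans_lt hj

lemma mem_pruneTwig_iff : a ∈ pruneTwig S i ↔ a ∈ S ∧ a ≠ i ∧ ¬ isAnc i a := by
  simp only [pruneTwig, descIn, Finset.mem_sdiff, Finset.mem_insert, Finset.mem_filter]
  tauto

lemma pruneTwig_mem_trees (hS : S ∈ trees L) (hi : i ≠ 0) : pruneTwig S i ∈ trees L := by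
  obtain ⟨h0, hpar, hlt⟩ := mem_trees_iff.mp hS
  refine mem_trees_iff.mpr ⟨?_, fun a ha ha1 => ?_, fun a ha => ?_⟩
  · exact mem_pruneTwig_iff.mpr ⟨h0, hi.symm, fun h => by have := h.lt; omega⟩
  · obtain ⟨haS, hai, hanc⟩ := mem_pruneTwig_iff.mp ha
    refine mem_pruneTwig_iff.mpr ⟨hpar a haS ha1, fun h => hanc (h ▸ isAnc_half ha1), fun h => ?_⟩
    exact hanc (isAnc_of_half ha1 h)
  · exact hlt a (mem_pruneTwig_iff.mp ha).1

lemma mem_tNg_iff : T ∈ tNg L S ↔ ∃ j, j < 2 ^ L ∧ j ∉ S ∧ growTwig S j = T := by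
  simp only [tNg, Finset.mem_image, Finset.mem_filter, Finset.mem_range, and_assoc]

lemma mem_tNp_iff : T ∈ tNp S ↔ ∃ i, i ∈ S ∧ i ≠ 0 ∧
    (∀ a ∈ S, isAnc i a → ∀ b ∈ S, isAnc i b → a = b ∨ isAnc a b ∨ isAnc b a) ∧
    pruneTwig S i = T := by
  simp only [tNp, twigPruneCands, descIn, Finset.mem_image, Finset.mem_filter, and_assoc, and_imp]

lemma mem_tNp_growTwig (hS : S ∈ trees L) (hjS : j ∉ S) :
    S ∈ tNp (growTwig S j) := by
  obtain ⟨h0, -, -⟩ := mem_trees_iff.mp hS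
  have hne : (ancPath j \ S).Nonempty := ⟨j, Finset.mem_sdiff.mpr ⟨self_mem_ancPath, hjS⟩⟩
  set i := (ancPath j \ S).min' hne with hi
  obtain ⟨hij, hiS⟩ := Finset.mem_sdiff.mp (Finset.min'_mem _ hne)
  rw [← hi] at hij hiS
  have hnz : ∀ a, a ∉ S → a ≠ 0 := fun a ha h => ha (h ▸ h0)
  have hdesc : ∀ a ∈ growTwig S j, isAnc i a → a ∈ ancPath j ∧ a ∉ S := by
    intro a ha hanc
    have haS : a ∉ S := fun h => hiS (hanc.mem_tree hS h)
    exact ⟨(Finset.mem_union.mp ha).resolve_left haS, haS⟩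
  refine mem_tNp_iff.mpr ⟨i, Finset.mem_union_right _ hij, hnz i hiS, ?_, ?_⟩
  · intro a ha ha' b hb hb'
    obtain ⟨h1, h2⟩ := hdesc a ha ha'
    obtain ⟨h3, h4⟩ := hdesc b hb hb'
    exact ancPath_comparable h1 h3 (hnz a h2) (hnz b h4)
  · ext a
    rw [mem_pruneTwig_iff]
    constructor
    · rintro ⟨ha, hai, hanc⟩
      by_contra haS
      have haj := (Finset.mem_union.mp ha).resolve_left haS
      rcases ancPath_comparable haj hij (hnz a haS) (hnz i hiS) with h | h | h
      · exact hai h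
      · have := Finset.min'_le (ancPath j \ S) a (Finset.mem_sdiff.mpr ⟨haj, haS⟩)
        have := h.lt
        omega
      · exact hanc h
    · intro ha
      exact ⟨Finset.mem_union_left _ ha, fun h => hiS (h ▸ ha),
        fun h => hiS (h.mem_tree hS ha)⟩

lemma mem_tNg_pruneTwig (hS : S ∈ trees L) (hiS : i ∈ S)
    (htwig : ∀ a ∈ S, isAnc i a → ∀ b ∈ S, isAnc i b → a = b ∨ isAnc a b ∨ isAnc b a) :
    S ∈ tNg L (pruneTwig S i) := by
  obtain ⟨-, -, hlt⟩ := mem_trees_iff.mp hS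
  have hne : (insert i (descIn S i)).Nonempty := Finset.insert_nonempty _ _
  set j := (insert i (descIn S i)).max' hne with hj
  have hjm : j ∈ insert i (descIn S i) := Finset.max'_mem _ hne
  have hle : ∀ a ∈ S, isAnc i a → a ≤ j := fun a ha h =>
    Finset.le_max' _ _ (Finset.mem_insert_of_mem (Finset.mem_filter.mpr ⟨ha, h⟩))
  have hjS' : j = i ∨ j ∈ S ∧ isAnc i j := by
    rcases Finset.mem_insert.mp hjm with h | h
    · exact Or.inl h
    · exact Or.inr (Finset.mem_filter.mp h)
  have hjS : j ∈ S := by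
    rcases hjS' with h | h
    · rw [h]; exact hiS
    · exact h.1
  refine mem_tNg_iff.mpr ⟨j, hlt j hjS, ?_, ?_⟩
  · rw [mem_pruneTwig_iff]
    rintro ⟨-, h1, h2⟩
    rcases hjS' with h | h
    · exact h1 h
    · exact h2 h.2
  · ext a
    simp only [growTwig, Finset.mem_union, mem_pruneTwig_iff]
    constructor
    · rintro (h | h)
      · exact h.1
      · exact ancPath_subset hS hjS h
    · intro haS
      by_cases hai : a = i
      · right
        rcases hjS' with h | h
        · rw [hai, h]; exact self_mem_ancPath
        · rw [hai]; exact h.2.mem_ancPath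
      · by_cases hanc : isAnc i a
        · right
          have h1 := hle a haS hanc
          rcases hjS' with h | h
          · have := hanc.lt
            omega
          · rcases htwig a haS hanc j hjS h.2 with h2 | h2 | h2
            · rw [h2]; exact self_mem_ancPath
            · exact h2.mem_ancPath
            · have := h2.lt
              omega
        · exact Or.inl ⟨haS, hai, hanc⟩

/-- Twig moves reach the smallest tree spanned by the signals. -/
theorem informedMoves_twiggy {B : Finset ℕ} (hB : B ⊆ T) (hstar : T ∈ trees L)
    (hmin : ∀ U ∈ trees L, B ⊆ U → T ⊆ U) : InformedMoves L B T (tNg L) tNp where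
  grow S hS U hU := by
    obtain ⟨j, hjL, hjS, rfl⟩ := mem_tNg_iff.mp hU
    have hjU : j ∈ growTwig S j := Finset.mem_union_right _ self_mem_ancPath
    refine ⟨growTwig_mem_trees hS hjL, ?_, ?_, mem_tNp_growTwig hS hjS⟩
    · exact (Finset.ssubset_iff_of_subset Finset.subset_union_left).mpr ⟨j, hjU, hjS⟩
    · refine (Finset.card_le_card ?_).trans (card_ancPath_le hjL)
      rw [growTwig, Finset.union_sdiff_left]
      exact Finset.sdiff_subset
  prune S hS U hU := by
    obtain ⟨i, hiS, hi0, htwig, rfl⟩ := mem_tNp_iff.mp hU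
    refine ⟨pruneTwig_mem_trees hS hi0, ?_, mem_tNg_pruneTwig hS hiS htwig⟩
    refine (Finset.ssubset_iff_of_subset fun a ha => (mem_pruneTwig_iff.mp ha).1).mpr
      ⟨i, hiS, fun h => (mem_pruneTwig_iff.mp h).2.1 rfl⟩
  grow_card S _ := card_image_le_two_pow _ fun j hj =>
    Finset.mem_range.mp (Finset.mem_filter.mp hj).1
  prune_card S hS := card_image_le_two_pow _ fun j hj =>
    (mem_trees_iff.mp hS).2.2 j (Finset.mem_filter.mp hj).1
  exists_grow S hS hBS := by
    obtain ⟨j, hjB, hjS⟩ := Finset.not_subset.mp hBS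
    have hjL := (mem_trees_iff.mp hstar).2.2 j (hB hjB)
    refine ⟨growTwig S j, mem_tNg_iff.mpr ⟨j, hjL, hjS, rfl⟩, Finset.not_disjoint_iff.mpr
      ⟨j, Finset.mem_sdiff.mpr ⟨Finset.mem_union_right _ self_mem_ancPath, hjS⟩, hjB⟩⟩
  exists_prune S hS hBS hne := by
    have hne' := sdiff_nonempty_of_ne (hmin S hS hBS) hne
    set j := (S \ T).max' hne' with hj
    obtain ⟨hjS, hjT⟩ := Finset.mem_sdiff.mp (Finset.max'_mem _ hne')
    rw [← hj] at hjS hjT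
    have hj0 : j ≠ 0 := fun h => hjT (h ▸ (mem_trees_iff.mp hstar).1)
    have hdesc : ∀ a ∈ S, ¬ isAnc j a := by
      intro a ha hanc
      have haT : a ∉ T := fun h => hjT (hanc.mem_tree hstar h)
      have := Finset.le_max' (S \ T) a (Finset.mem_sdiff.mpr ⟨ha, haT⟩)
      have := hanc.lt
      omega
    refine ⟨pruneTwig S j, mem_tNp_iff.mpr ⟨j, hjS, hj0, fun a ha h => absurd h (hdesc a ha), rfl⟩,
      Finset.disjoint_left.mpr fun a ha haB => ?_⟩
    rw [Finset.mem_sdiff, mem_pruneTwig_iff] at ha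
    by_cases haj : a = j
    · exact hjT (haj ▸ hB haB)
    · exact ha.2 ⟨ha.1, haj, hdesc a ha.1⟩

end Combinatorics

/-! ### Orthogonality of the Haar design -/

section Haar

lemma sum_range_mul_div (s Q : ℕ) (F : ℕ → ℝ) :
    ∑ i ∈ Finset.range (s * Q), F (i / s) = s * ∑ q ∈ Finset.range Q, F q := by
  induction Q with
  | zero => simp
  | succ Q ih =>
    have h : ∑ x ∈ Finset.range s, F ((s * Q + x) / s) = s * F Q := by
      rw [Finset.sum_congr rfl (g := fun _ => F Q), Finset.sum_const, Finset.card_range,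
        nsmul_eq_mul]
      intro x hx
      have hx := Finset.mem_range.mp hx
      rw [Nat.mul_add_div (by omega), Nat.div_eq_of_lt hx, add_zero]
    rw [mul_add, mul_one, Finset.sum_range_add, ih, h, Finset.sum_range_succ, mul_add]

/-- The values of a Haar wavelet on the half-blocks of its level, the `k`-th block being the
support. -/
def haarStep (l k q : ℕ) : ℝ :=
  (2 : ℝ) ^ ((l : ℝ) / 2) * if q = 2 * k then 1 else if q = 2 * k + 1 then -1 else 0

lemma sum_haarStep_mul {k K : ℕ} (l : ℕ) (hk : k < K) (g : ℕ → ℝ) :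
    ∑ q ∈ Finset.range (2 * K), haarStep l k q * g q =
      (2 : ℝ) ^ ((l : ℝ) / 2) * (g (2 * k) - g (2 * k + 1)) := by
  have h : ∀ q, haarStep l k q * g q =
      (if q = 2 * k then (2 : ℝ) ^ ((l : ℝ) / 2) * g (2 * k) else 0) -
        if q = 2 * k + 1 then (2 : ℝ) ^ ((l : ℝ) / 2) * g (2 * k + 1) else 0 := by
    intro q
    unfold haarStep
    split_ifs with h1 h2 h3
    · omega
    · rw [h1]; ring
    · rw [h3]; ring
    · ring
  simp_rw [h, Finset.sum_sub_distrib, Finset.sum_ite_eq', Finset.mem_range]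
  rw [if_pos (by omega), if_pos (by omega)]
  ring

variable {m j j' : ℕ}

lemma log_succ_le (hj0 : j ≠ 0) (hj : j < 2 ^ m) : Nat.log 2 j + 1 ≤ m :=
  Nat.log_lt_of_lt_pow hj0 hj

lemma sub_two_pow_log_lt (j : ℕ) : j - 2 ^ Nat.log 2 j < 2 ^ Nat.log 2 j := by
  have h := Nat.lt_pow_succ_log_self (b := 2) (by norm_num) j
  rw [pow_succ] at h
  have := Nat.two_pow_pos (Nat.log 2 j)
  omega

lemma haarCol_eq_haarStep (hj0 : j ≠ 0) (hj : j < 2 ^ m) (i : ℕ) :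
    haarCol (nOf m) j i =
      haarStep (Nat.log 2 j) (j - 2 ^ Nat.log 2 j) (i / 2 ^ (m - Nat.log 2 j)) := by
  have hl := log_succ_le hj0 hj
  rw [haarCol, if_neg hj0, haarStep]
  set l := Nat.log 2 j
  set k := j - 2 ^ l
  set s := 2 ^ (m - l) with hs
  have hs0 : 0 < s := by positivity
  have hs0' : (0 : ℝ) < s := by exact_mod_cast hs0
  have hn : (nOf m : ℝ) = 2 ^ l * (2 * s) := by
    rw [nOf, hs]; push_cast
    rw [← pow_succ', ← pow_add]; congr 1; omega
  have hx : (2 : ℝ) ^ l * (((i : ℝ) + 1) / (nOf m : ℕ)) = ((i : ℝ) + 1) / (2 * s) := by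
    rw [hn]; field_simp
  rw [hx, haarMother]
  congr 1
  have e1 : 0 < ((i : ℝ) + 1) / (2 * s) - k ↔ 2 * k * s ≤ i := by
    rw [sub_pos, lt_div_iff₀ (by positivity), ← Nat.lt_succ_iff]
    constructor
    · intro h
      have : ((2 * k * s : ℕ) : ℝ) < ((i + 1 : ℕ) : ℝ) := by push_cast; linarith
      exact_mod_cast this
    · intro h
      have : ((2 * k * s : ℕ) : ℝ) < ((i + 1 : ℕ) : ℝ) := by exact_mod_cast h
      push_cast at this; linarith
  have e2 : ((i : ℝ) + 1) / (2 * s) - k ≤ 1 / 2 ↔ i < (2 * k + 1) * s := by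
    rw [sub_le_iff_le_add, div_le_iff₀ (by positivity), ← Nat.succ_le_iff]
    constructor
    · intro h
      have : ((i + 1 : ℕ) : ℝ) ≤ (((2 * k + 1) * s : ℕ) : ℝ) := by push_cast; linarith
      exact_mod_cast this
    · intro h
      have : ((i + 1 : ℕ) : ℝ) ≤ (((2 * k + 1) * s : ℕ) : ℝ) := by exact_mod_cast h
      push_cast at this; linarith
  have e3 : ((i : ℝ) + 1) / (2 * s) - k ≤ 1 ↔ i < (2 * k + 2) * s := by
    rw [sub_le_iff_le_add, div_le_iff₀ (by positivity), ← Nat.succ_le_iff]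
    constructor
    · intro h
      have : ((i + 1 : ℕ) : ℝ) ≤ (((2 * k + 2) * s : ℕ) : ℝ) := by push_cast; linarith
      exact_mod_cast this
    · intro h
      have : ((i + 1 : ℕ) : ℝ) ≤ (((2 * k + 2) * s : ℕ) : ℝ) := by exact_mod_cast h
      push_cast at this; linarith
  have e4 : 1 / 2 < ((i : ℝ) + 1) / (2 * s) - k ↔ (2 * k + 1) * s ≤ i := by
    rw [← not_le, e2, not_lt]
  simp only [e1, e2, e3, e4]
  simp only [← Nat.le_div_iff_mul_le hs0, ← Nat.div_lt_iff_lt_mul hs0]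
  have h1 : (2 * k ≤ i / s ∧ i / s < 2 * k + 1) ↔ i / s = 2 * k := by omega
  have h2 : (2 * k + 1 ≤ i / s ∧ i / s < 2 * k + 2) ↔ i / s = 2 * k + 1 := by omega
  simp only [h1, h2]

lemma sum_haarCol_mul (hj0 : j ≠ 0) (hj : j < 2 ^ m) (g : ℕ → ℝ) :
    ∑ i ∈ Finset.range (nOf m), haarCol (nOf m) j i * g (i / 2 ^ (m - Nat.log 2 j)) =
      2 ^ (m - Nat.log 2 j) * ((2 : ℝ) ^ ((Nat.log 2 j : ℝ) / 2) *
        (g (2 * (j - 2 ^ Nat.log 2 j)) - g (2 * (j - 2 ^ Nat.log 2 j) + 1))) := by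
  have hl := log_succ_le hj0 hj
  simp_rw [haarCol_eq_haarStep hj0 hj]
  have hn : nOf m = 2 ^ (m - Nat.log 2 j) * (2 * 2 ^ Nat.log 2 j) := by
    rw [nOf, ← pow_succ', ← pow_add]; congr 1; omega
  rw [hn, sum_range_mul_div _ _ fun q =>
    haarStep (Nat.log 2 j) (j - 2 ^ Nat.log 2 j) q * g q,
    sum_haarStep_mul _ (sub_two_pow_log_lt j)]
  push_cast
  rfl

lemma sum_haarCol_sq (hj : j < 2 ^ m) :
    ∑ i ∈ Finset.range (nOf m), haarCol (nOf m) j i ^ 2 = nOf m := by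
  rcases eq_or_ne j 0 with rfl | hj0
  · simp [haarCol]
  have hl := log_succ_le hj0 hj
  have h := sum_haarCol_mul hj0 hj (haarStep (Nat.log 2 j) (j - 2 ^ Nat.log 2 j))
  simp_rw [← haarCol_eq_haarStep hj0 hj, ← pow_two] at h
  rw [h]
  have h2 : (2 : ℝ) ^ ((Nat.log 2 j : ℝ) / 2) * 2 ^ ((Nat.log 2 j : ℝ) / 2) =
      2 ^ Nat.log 2 j := by
    rw [← Real.rpow_add (by norm_num), add_halves, Real.rpow_natCast]
  have hn : (nOf m : ℝ) = 2 ^ (m - Nat.log 2 j) * (2 * 2 ^ Nat.log 2 j) := by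
    rw [nOf, ← pow_succ', ← pow_add]; push_cast; congr 1; omega
  rw [hn, ← h2]
  simp only [haarStep, if_true, if_neg (Nat.succ_ne_self _)]
  ring

lemma sum_haarCol_mul_of_log_le (hj : j < 2 ^ m) (hj' : j' < 2 ^ m) (hne : j ≠ j')
    (hj0 : j ≠ 0) (hle : Nat.log 2 j' ≤ Nat.log 2 j) :
    ∑ i ∈ Finset.range (nOf m), haarCol (nOf m) j i * haarCol (nOf m) j' i = 0 := by
  rcases eq_or_ne j' 0 with rfl | hj0'
  · have h := sum_haarCol_mul hj0 hj fun _ => 1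
    simp only [sub_self, mul_zero] at h
    simpa [haarCol] using h
  have hl := log_succ_le hj0 hj
  rcases hle.eq_or_lt with heq | hlt
  · have h := sum_haarCol_mul hj0 hj (haarStep (Nat.log 2 j') (j' - 2 ^ Nat.log 2 j'))
    rw [← heq] at h
    simp_rw [← haarCol_eq_haarStep hj0' hj'] at h
    rw [h]
    have h1 := Nat.pow_log_le_self 2 hj0
    have h2 := Nat.pow_log_le_self 2 hj0'
    rw [← heq] at h1
    have h3 : j - 2 ^ Nat.log 2 j' ≠ j' - 2 ^ Nat.log 2 j' := by omega
    simp only [haarStep]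
    rw [if_neg (by omega), if_neg (by omega), if_neg (by omega), if_neg (by omega)]
    ring
  · have h := sum_haarCol_mul hj0 hj fun q => haarStep (Nat.log 2 j')
      (j' - 2 ^ Nat.log 2 j') (q / 2 ^ (Nat.log 2 j - Nat.log 2 j'))
    have hdiv : ∀ i, i / 2 ^ (m - Nat.log 2 j) / 2 ^ (Nat.log 2 j - Nat.log 2 j') =
        i / 2 ^ (m - Nat.log 2 j') := by
      intro i
      rw [Nat.div_div_eq_div_mul, ← pow_add]
      congr 2; omega
    simp_rw [hdiv, ← haarCol_eq_haarStep hj0' hj'] at h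
    rw [h]
    obtain ⟨d, hd⟩ : ∃ d, Nat.log 2 j - Nat.log 2 j' = d + 1 :=
      ⟨Nat.log 2 j - Nat.log 2 j' - 1, by omega⟩
    rw [hd, pow_succ', ← Nat.div_div_eq_div_mul, ← Nat.div_div_eq_div_mul,
      show ∀ k, (2 * k + 1) / 2 = 2 * k / 2 by intro k; omega, sub_self]
    ring

lemma sum_haarCol_mul_haarCol (hj : j < 2 ^ m) (hj' : j' < 2 ^ m) (hne : j ≠ j') :
    ∑ i ∈ Finset.range (nOf m), haarCol (nOf m) j i * haarCol (nOf m) j' i = 0 := by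
  have key : ∀ {a b : ℕ}, a < 2 ^ m → b < 2 ^ m → a ≠ b → Nat.log 2 b ≤ Nat.log 2 a → a ≠ 0 →
      ∑ i ∈ Finset.range (nOf m), haarCol (nOf m) a i * haarCol (nOf m) b i = 0 :=
    fun ha hb hab hle ha0 => sum_haarCol_mul_of_log_le ha hb hab ha0 hle
  by_cases h : j ≠ 0 ∧ Nat.log 2 j' ≤ Nat.log 2 j
  · exact key hj hj' hne h.2 h.1
  · simp_rw [mul_comm (haarCol (nOf m) j _)]
    refine key hj' hj hne.symm ?_ ?_
    · by_cases h0 : j = 0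
      · simp [h0]
      · have := fun h' => h ⟨h0, h'⟩
        omega
    · rintro rfl
      exact h ⟨hne, by simp⟩

lemma colDot_Yvec {L : ℕ} {β : ℕ → ℝ} {B : Finset ℕ} (hL : L ≤ m) (hB : ∀ j ∈ B, j < 2 ^ L)
    (hβ : ∀ j, j ∉ B → β j = 0) (ε : Fin (nOf m) → ℝ) (hj : j < 2 ^ L) :
    colDot (nOf m) (Yvec (nOf m) β B ε) j = nOf m * β j + colDot (nOf m) ε j := by
  have hLm : 2 ^ L ≤ 2 ^ m := Nat.pow_le_pow_right (by norm_num) hL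
  simp only [colDot, Yvec, signalVec, mul_add, Finset.sum_add_distrib, Finset.mul_sum]
  rw [Finset.sum_comm]
  congr 1
  have h : ∀ b ∈ B, ∑ i : Fin (nOf m), haarCol (nOf m) j i * (β b * haarCol (nOf m) b i) =
      if b = j then nOf m * β j else 0 := by
    intro b hb
    have hbm := (hB b hb).trans_le hLm
    rw [Fin.sum_univ_eq_sum_range
      (fun i => haarCol (nOf m) j i * (β b * haarCol (nOf m) b i)) (nOf m)]
    simp_rw [mul_left_comm _ (β b), ← Finset.mul_sum]
    split_ifs with hbj
    · subst hbj
      simp_rw [← pow_two]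
      rw [sum_haarCol_sq hbm, mul_comm]
    · rw [sum_haarCol_mul_haarCol (hj.trans_le hLm) hbm (Ne.symm hbj), mul_zero]
  rw [Finset.sum_congr rfl h, Finset.sum_ite_eq']
  split_ifs with hjB
  · rfl
  · rw [hβ j hjB, mul_zero]

end Haar

/-! ### Gaussian concentration of the noise coefficients -/

section Concentration

open ProbabilityTheory

instance (n : ℕ) : IsProbabilityMeasure (gauss n) := by unfold gauss; infer_instance

lemma hasSubgaussianMGF_gaussianReal : HasSubgaussianMGF id 1 (gaussianReal 0 1) where
  integrable_exp_mul t := integrable_exp_mul_gaussianReal t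
  mgf_le t := by simp [mgf_id_gaussianReal]

lemma hasSubgaussianMGF_mul_eval (n : ℕ) (a : ℝ) (i : Fin n) :
    HasSubgaussianMGF (fun ε : Fin n → ℝ => a * ε i) (a ^ 2).toNNReal (gauss n) := by
  have h : HasSubgaussianMGF (fun ε : Fin n → ℝ => ε i) 1 (gauss n) := by
    have hmp : MeasurePreserving (fun ε : Fin n → ℝ => ε i) (gauss n) (gaussianReal 0 1) :=
      measurePreserving_eval (fun _ : Fin n => gaussianReal 0 1) i
    have hid := hasSubgaussianMGF_gaussianReal
    rw [← hmp.map_eq] at hid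
    exact HasSubgaussianMGF.of_map hmp.measurable.aemeasurable hid
  have hcast : (a ^ 2).toNNReal = (NNReal.mk (a ^ 2) (sq_nonneg a)) * 1 := by
    rw [mul_one]; exact Real.toNNReal_of_nonneg (sq_nonneg a)
  rw [hcast]
  exact h.const_mul a

variable {n j : ℕ}

lemma hasSubgaussianMGF_colDot (hcol : ∑ i : Fin n, haarCol n j i.val ^ 2 = n) :
    HasSubgaussianMGF (fun ε : Fin n → ℝ => colDot n ε j) n (gauss n) := by
  have hind : iIndepFun (fun (i : Fin n) (ε : Fin n → ℝ) => haarCol n j i.val * ε i)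
      (gauss n) :=
    iIndepFun_pi (μ := fun _ : Fin n => gaussianReal 0 1)
      (X := fun (i : Fin n) (x : ℝ) => haarCol n j i.val * x)
      fun i => (measurable_const_mul _).aemeasurable
  have h := HasSubgaussianMGF.sum_of_iIndepFun hind (s := Finset.univ)
    fun i _ => hasSubgaussianMGF_mul_eval n (haarCol n j i.val) i
  have hc : (∑ i : Fin n, (haarCol n j i.val ^ 2).toNNReal) = n := by
    rw [← Real.toNNReal_sum_of_nonneg fun i _ => sq_nonneg _, hcol, Real.toNNReal_natCast]
  rw [hc] at h
  exact h

lemma measureReal_sq_colDot_gt (hn : 0 < n) (hcol : ∑ i : Fin n, haarCol n j i.val ^ 2 = n) :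
    (gauss n).real {ε | 4 * n * Real.log n < colDot n ε j ^ 2} ≤ 2 / (n : ℝ) ^ 2 := by
  have hn' : (0 : ℝ) < n := by exact_mod_cast hn
  have hlog : 0 ≤ Real.log n := Real.log_natCast_nonneg n
  set s := Real.sqrt (4 * n * Real.log n) with hs
  have hs2 : s ^ 2 = 4 * n * Real.log n := Real.sq_sqrt (by positivity)
  have hexp : Real.exp (-s ^ 2 / (2 * (n : ℝ≥0))) = 1 / (n : ℝ) ^ 2 := by
    have : -s ^ 2 / (2 * ((n : ℝ≥0) : ℝ)) = -Real.log ((n : ℝ) ^ 2) := by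
      rw [hs2, Real.log_pow]
      push_cast
      field_simp
      ring
    rw [this, Real.exp_neg, Real.exp_log (by positivity), one_div]
  have h := hasSubgaussianMGF_colDot hcol
  have h1 := h.measure_ge_le (ε := s) (Real.sqrt_nonneg _)
  have h2 := h.neg.measure_ge_le (ε := s) (Real.sqrt_nonneg _)
  rw [hexp] at h1 h2
  have hsub : {ε : Fin n → ℝ | 4 * n * Real.log n < colDot n ε j ^ 2} ⊆
      {ε | s ≤ colDot n ε j} ∪ {ε | s ≤ (-fun ε => colDot n ε j) ε} := by
    intro ε hε
    simp only [Set.mem_ofPred_eq, Set.mem_union, Pi.neg_apply] at hε ⊢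
    have := Real.sqrt_le_sqrt hε.le
    rw [Real.sqrt_sq_eq_abs, ← hs] at this
    exact le_abs.mp this
  calc (gauss n).real {ε | 4 * n * Real.log n < colDot n ε j ^ 2}
      ≤ _ := measureReal_mono hsub
    _ ≤ _ := measureReal_union_le _ _
    _ ≤ 1 / (n : ℝ) ^ 2 + 1 / (n : ℝ) ^ 2 := add_le_add h1 h2
    _ = 2 / (n : ℝ) ^ 2 := by ring

/-- The noise coefficients below `N ≤ n / 2` are all at most `√(4 n log n)` in absolute value with
probability at least `1 - 1 / n`. -/
lemma one_sub_le_gauss_noise {N : ℕ} (hn : 0 < n) (hN : 2 * N ≤ n)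
    (hcol : ∀ j < N, ∑ i : Fin n, haarCol n j i.val ^ 2 = n) :
    ENNReal.ofReal (1 - 1 / n) ≤
      gauss n {ε | ∀ j < N, colDot n ε j ^ 2 ≤ 4 * n * Real.log n} := by
  have hn' : (0 : ℝ) < n := by exact_mod_cast hn
  have hmeas : ∀ j, Measurable fun ε : Fin n → ℝ => colDot n ε j := fun j => by
    unfold colDot; fun_prop
  set E := {ε : Fin n → ℝ | ∀ j < N, colDot n ε j ^ 2 ≤ 4 * n * Real.log n} with hE
  have hEm : MeasurableSet E := by
    have : E = ⋂ j ∈ Finset.range N, {ε | colDot n ε j ^ 2 ≤ 4 * n * Real.log n} := by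
      ext ε; simp [hE]
    rw [this]
    exact Finset.measurableSet_biInter _ fun j _ =>
      measurableSet_le ((hmeas j).pow_const 2) measurable_const
  have hcompl : (gauss n).real Eᶜ ≤ 1 / n := by
    have hsub : Eᶜ ⊆ ⋃ j ∈ Finset.range N, {ε | 4 * n * Real.log n < colDot n ε j ^ 2} := by
      intro ε hε
      simpa [hE] using hε
    calc (gauss n).real Eᶜ ≤ _ := measureReal_mono hsub (measure_ne_top _ _)
      _ ≤ ∑ j ∈ Finset.range N, (gauss n).real {ε | 4 * n * Real.log n < colDot n ε j ^ 2} :=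
          measureReal_biUnion_finset_le _ _
      _ ≤ ∑ j ∈ Finset.range N, 2 / (n : ℝ) ^ 2 :=
          Finset.sum_le_sum fun j hj =>
            measureReal_sq_colDot_gt hn (hcol j (Finset.mem_range.mp hj))
      _ = 2 * N / (n : ℝ) ^ 2 := by rw [Finset.sum_const, Finset.card_range, nsmul_eq_mul]; ring
      _ ≤ n / (n : ℝ) ^ 2 := by gcongr; exact_mod_cast hN
      _ = 1 / n := by field_simp
  rw [measureReal_compl hEm, probReal_univ] at hcompl
  rw [← ofReal_measureReal]
  exact ENNReal.ofReal_le_ofReal (by linarith)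

end Concentration

/-! ### Posterior ratios as products of node factors -/

section PosteriorRatio

/-- The factor by which splitting the node `j` multiplies the posterior weight. -/
def nodeFactor (n : ℕ) (p : ℝ) (Y : Fin n → ℝ) (j : ℕ) : ℝ :=
  p * (1 - p) * (1 + n : ℝ) ^ (-(1 / 2) : ℝ) *
    Real.exp (colDot n Y j ^ 2 / (2 * ((n : ℝ) + 1)))

variable {L n : ℕ} {p : ℝ} {Y : Fin n → ℝ} {S T : Finset ℕ}

lemma postWt_eq (hS : S ∈ trees L) :
    postWt n p Y S = (2 * π) ^ (-(n : ℝ) / 2) * Real.exp (-(1 / 2) * ∑ i, Y i ^ 2) *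
      ∏ j ∈ S, nodeFactor n p Y j := by
  have hpow : (1 + n : ℝ) ^ (-(S.card : ℝ) / 2) = ((1 + n : ℝ) ^ (-(1 / 2) : ℝ)) ^ S.card := by
    rw [← Real.rpow_natCast, ← Real.rpow_mul (by positivity)]
    congr 1; ring
  have hexp : Real.exp (-(1 / 2) * ((∑ i, Y i ^ 2) -
      (1 / ((n : ℝ) + 1)) * ∑ j ∈ S, colDot n Y j ^ 2)) =
      Real.exp (-(1 / 2) * ∑ i, Y i ^ 2) *
        Real.exp (∑ j ∈ S, colDot n Y j ^ 2 / (2 * ((n : ℝ) + 1))) := by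
    rw [← Real.exp_add, ← Finset.sum_div]
    congr 1
    field_simp
    ring
  simp only [postWt, priorWt, margLik, nodeFactor, card_extSet hS, Finset.prod_mul_distrib,
    Finset.prod_const]
  rw [hpow, hexp, Real.exp_sum]
  ring

lemma nodeFactor_pos (hp0 : 0 < p) (hp1 : p < 1) (j : ℕ) : 0 < nodeFactor n p Y j := by
  have : 0 < 1 - p := by linarith
  unfold nodeFactor
  positivity

lemma postWt_pos (hp0 : 0 < p) (hp1 : p < 1) (hS : S ∈ trees L) : 0 < postWt n p Y S := by
  have := Finset.prod_pos fun j (_ : j ∈ S) => nodeFactor_pos (Y := Y) hp0 hp1 j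
  rw [postWt_eq hS]
  positivity

lemma post_pos (hp0 : 0 < p) (hp1 : p < 1) (hS : S ∈ trees L) : 0 < post L n p Y S :=
  div_pos (postWt_pos hp0 hp1 hS)
    (Finset.sum_pos (fun _ hT => postWt_pos hp0 hp1 hT) ⟨S, hS⟩)

lemma post_eq_mul_prod (hS : S ∈ trees L) (hT : T ∈ trees L) (hST : S ⊆ T) :
    post L n p Y T = post L n p Y S * ∏ j ∈ T \ S, nodeFactor n p Y j := by
  rw [post, post, postWt_eq hS, postWt_eq hT, ← Finset.prod_sdiff hST]
  ring

end PosteriorRatio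

section Dichotomy

variable {L m : ℕ} {c A C : ℝ} {β : ℕ → ℝ} {B Sstar : Finset ℕ}

lemma log_nOf (m : ℕ) : Real.log (nOf m) = (m + 1) * Real.log 2 := by
  rw [nOf]; push_cast
  rw [Real.log_pow]; push_cast; rfl

lemma le_two_mul_log_nOf (m : ℕ) : (m : ℝ) + 1 ≤ 2 * Real.log (nOf m) := by
  rw [log_nOf]
  have := Real.log_two_gt_d9
  nlinarith [(Nat.cast_nonneg m : (0 : ℝ) ≤ m)]

lemma one_le_log_nOf (hm : 1 ≤ m) : 1 ≤ Real.log (nOf m) := by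
  have := le_two_mul_log_nOf m
  have : (1 : ℝ) ≤ m := by exact_mod_cast hm
  linarith

lemma eight_le_nOf (hm : 2 ≤ m) : (8 : ℝ) ≤ nOf m := by
  have : 2 ^ 3 ≤ nOf m := Nat.pow_le_pow_right (by norm_num) (by omega)
  exact_mod_cast this

lemma splitP_pos {n : ℕ} (hn : 0 < n) : 0 < splitP n c :=
  Real.rpow_pos_of_pos (by exact_mod_cast hn) _

lemma splitP_le_half {n : ℕ} (hn : 2 ≤ n) (hc : 1 ≤ c) : splitP n c ≤ 1 / 2 := by
  have hn' : (2 : ℝ) ≤ n := by exact_mod_cast hn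
  calc splitP n c ≤ (n : ℝ) ^ (-1 : ℝ) :=
        Real.rpow_le_rpow_of_exponent_le (by linarith) (by linarith)
    _ = 1 / n := by rw [Real.rpow_neg_one, one_div]
    _ ≤ 1 / 2 := by gcongr

/-- A node with a small empirical coefficient is penalized. -/
lemma nodeFactor_le {n : ℕ} {Y : Fin n → ℝ} {j : ℕ} (hn : 2 ≤ n) (hc : 1 ≤ c)
    (h : colDot n Y j ^ 2 ≤ 4 * n * Real.log n) :
    nodeFactor n (splitP n c) Y j ≤ (n : ℝ) ^ (3 / 2 - c) := by
  have hn' : (0 : ℝ) < n := by positivity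
  have hlog : 0 ≤ Real.log n := Real.log_natCast_nonneg n
  have hp0 := splitP_pos (c := c) (show 0 < n by omega)
  have hp1 := splitP_le_half hn hc
  have h1 : splitP n c * (1 - splitP n c) ≤ (n : ℝ) ^ (-c) := by
    have : splitP n c = (n : ℝ) ^ (-c) := rfl
    nlinarith
  have h2 : (1 + n : ℝ) ^ (-(1 / 2) : ℝ) ≤ (n : ℝ) ^ (-(1 / 2) : ℝ) :=
    Real.rpow_le_rpow_of_nonpos hn' (by linarith) (by norm_num)
  have h3 : Real.exp (colDot n Y j ^ 2 / (2 * ((n : ℝ) + 1))) ≤ (n : ℝ) ^ (2 : ℝ) := by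
    rw [Real.rpow_def_of_pos hn', Real.exp_le_exp, div_le_iff₀ (by positivity)]
    nlinarith
  calc nodeFactor n (splitP n c) Y j
      ≤ (n : ℝ) ^ (-c) * (n : ℝ) ^ (-(1 / 2) : ℝ) * (n : ℝ) ^ (2 : ℝ) := by
        unfold nodeFactor; gcongr
    _ = (n : ℝ) ^ (3 / 2 - c) := by
        rw [← Real.rpow_add hn', ← Real.rpow_add hn']; congr 1; ring

lemma rpow_mul_exp_le_nodeFactor {n : ℕ} (Y : Fin n → ℝ) (j : ℕ) (hn : 4 ≤ n) (hc : 1 ≤ c) :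
    (n : ℝ) ^ (-(c + 2)) * Real.exp (colDot n Y j ^ 2 / (2 * ((n : ℝ) + 1))) ≤
      nodeFactor n (splitP n c) Y j := by
  have hn' : (4 : ℝ) ≤ n := by exact_mod_cast hn
  have hn0 : (0 : ℝ) < n := by linarith
  have hp0 := splitP_pos (c := c) (show 0 < n by omega)
  have hp1 := splitP_le_half (show 2 ≤ n by omega) hc
  have h1 : (1 + n : ℝ)⁻¹ ≤ (1 + n : ℝ) ^ (-(1 / 2) : ℝ) := by
    rw [← Real.rpow_neg_one]
    exact Real.rpow_le_rpow_of_exponent_le (by linarith) (by norm_num)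
  have h2 : (n : ℝ) ^ (-2 : ℝ) ≤ 1 / 2 * (1 + n : ℝ)⁻¹ := by
    rw [Real.rpow_neg hn0.le, Real.rpow_two, ← one_div, ← one_div, one_div_mul_one_div]
    exact one_div_le_one_div_of_le (by positivity) (by nlinarith)
  unfold nodeFactor
  gcongr
  calc (n : ℝ) ^ (-(c + 2)) = splitP n c * (n : ℝ) ^ (-2 : ℝ) := by
        rw [splitP, ← Real.rpow_add hn0]; congr 1; ring
    _ ≤ splitP n c * (1 / 2 * (1 + n : ℝ)⁻¹) := by gcongr
    _ = splitP n c * (1 / 2) * (1 + n : ℝ)⁻¹ := by ring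
    _ ≤ splitP n c * (1 - splitP n c) * (1 + n : ℝ) ^ (-(1 / 2) : ℝ) := by
        have h3 : 1 / 2 ≤ 1 - splitP n c := by linarith
        have h4 : 0 ≤ 1 - splitP n c := by linarith
        gcongr

/-- The empirical coefficient of a signal node is large. -/
lemma sq_colDot_signal_ge {z b : ℝ} {n : ℕ} (hn : 0 < n) (hlog : 1 ≤ Real.log n) (hA : 8 ≤ A)
    (hb : A * Real.log n / Real.sqrt n < |b|) (hz : z ^ 2 ≤ 4 * n * Real.log n) :
    9 / 16 * A ^ 2 * n * Real.log n ^ 2 ≤ (n * b + z) ^ 2 := by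
  have hn' : (0 : ℝ) < n := by exact_mod_cast hn
  have hs : 0 < Real.sqrt n := Real.sqrt_pos.mpr hn'
  have hs2 : Real.sqrt n * Real.sqrt n = n := Real.mul_self_sqrt hn'.le
  have hz' : |z| ≤ 2 * Real.sqrt n * Real.log n := by
    refine abs_le_of_sq_le_sq (hz.trans ?_) (by positivity)
    calc 4 * n * Real.log n ≤ 4 * n * (Real.log n * Real.log n) := by gcongr; nlinarith
      _ = (2 * Real.sqrt n * Real.log n) ^ 2 := by
        linear_combination (-4 * Real.log n ^ 2) * hs2
  have hb' : A * Real.sqrt n * Real.log n ≤ n * |b| := by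
    rw [div_lt_iff₀ hs] at hb
    calc A * Real.sqrt n * Real.log n = Real.sqrt n * (A * Real.log n) := by ring
      _ ≤ Real.sqrt n * (|b| * Real.sqrt n) := by gcongr
      _ = n * |b| := by linear_combination |b| * hs2
  have hlow : 3 / 4 * A * Real.sqrt n * Real.log n ≤ |n * b + z| := by
    have h1 : n * |b| - |z| ≤ |n * b + z| := by
      have := abs_sub_abs_le_abs_sub (n * b) (-z)
      rwa [abs_neg, sub_neg_eq_add, abs_mul, abs_of_pos hn'] at this
    have h2 : 8 * (Real.sqrt n * Real.log n) ≤ A * (Real.sqrt n * Real.log n) := by gcongr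
    linarith
  calc 9 / 16 * A ^ 2 * n * Real.log n ^ 2 = (3 / 4 * A * Real.sqrt n * Real.log n) ^ 2 := by
        linear_combination (-9 / 16 * A ^ 2 * Real.log n ^ 2) * hs2
    _ ≤ |n * b + z| ^ 2 := by gcongr
    _ = (n * b + z) ^ 2 := sq_abs _

/-- When the noise is controlled, the posterior penalizes noise nodes and rewards moves that
reach a signal node. -/
lemma posteriorDichotomy {n : ℕ} {Y : Fin n → ℝ} {z : ℕ → ℝ}
    {Ng Np : Finset ℕ → Finset (Finset ℕ)} (hn8 : (8 : ℝ) ≤ n) (hlog : 1 ≤ Real.log n)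
    (hLlog : (L : ℝ) + 1 ≤ 2 * Real.log n) (hc : 3 < c) (hA : 8 ≤ A)
    (hAc : 16 * (c + 2) ≤ A ^ 2) (hass : Assumption1 L n A C β B Sstar)
    (hcol : ∀ j < 2 ^ L, colDot n Y j = n * β j + z j)
    (hgood : ∀ j < 2 ^ L, z j ^ 2 ≤ 4 * n * Real.log n)
    (hmoves : InformedMoves L B Sstar Ng Np) :
    PosteriorDichotomy L n c A Y B Ng := by
  have hn4 : 4 ≤ n := by
    have : (4 : ℝ) ≤ n := by linarith
    exact_mod_cast this
  have hn0 : (0 : ℝ) < n := by linarith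
  have hp0 := splitP_pos (c := c) (show 0 < n by omega)
  have hp1 : splitP n c < 1 := by
    linarith [splitP_le_half (c := c) (show 2 ≤ n by omega) (by linarith)]
  have hlt : ∀ {T}, T ∈ trees L → ∀ j ∈ T, j < 2 ^ L := fun hT j hj =>
    Finset.mem_range.mp (subset_range_of_mem_trees hT hj)
  refine ⟨fun S hS => post_pos hp0 hp1 hS, fun S hS T hT hST hdis => ?_,
    fun S hS T hT hdis => ?_⟩
  · obtain ⟨i, hiT, hiS⟩ := Finset.exists_of_ssubset hST
    have hfac : ∀ j ∈ T \ S, nodeFactor n (splitP n c) Y j ≤ (n : ℝ) ^ (3 / 2 - c) := by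
      intro j hj
      have hjB : j ∉ B := Finset.disjoint_left.mp hdis hj
      have hjL := hlt hT j (Finset.mem_sdiff.mp hj).1
      refine nodeFactor_le (by omega) (by linarith) ?_
      rw [hcol j hjL, hass.support j hjB, mul_zero, zero_add]
      exact hgood j hjL
    have hone : (n : ℝ) ^ (3 / 2 - c) ≤ 1 :=
      Real.rpow_le_one_of_one_le_of_nonpos (by linarith) (by linarith)
    have hi : i ∈ T \ S := Finset.mem_sdiff.mpr ⟨hiT, hiS⟩
    have hprod : ∏ j ∈ T \ S, nodeFactor n (splitP n c) Y j ≤ (n : ℝ) ^ (3 / 2 - c) := by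
      rw [← Finset.mul_prod_erase _ _ hi]
      have h1 : ∏ j ∈ (T \ S).erase i, nodeFactor n (splitP n c) Y j ≤ 1 :=
        Finset.prod_le_one (fun j _ => (nodeFactor_pos hp0 hp1 j).le)
          fun j hj => (hfac j (Finset.mem_of_mem_erase hj)).trans hone
      exact (mul_le_of_le_one_right (nodeFactor_pos hp0 hp1 i).le h1).trans (hfac i hi)
    rw [post_eq_mul_prod hS hT hST.subset]
    calc (n : ℝ) ^ (c - 3 / 2) * (post L n (splitP n c) Y S *
          ∏ j ∈ T \ S, nodeFactor n (splitP n c) Y j)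
        ≤ (n : ℝ) ^ (c - 3 / 2) * (post L n (splitP n c) Y S * (n : ℝ) ^ (3 / 2 - c)) := by
          have := (post_pos (Y := Y) hp0 hp1 hS).le
          gcongr
      _ = post L n (splitP n c) Y S * ((n : ℝ) ^ (c - 3 / 2) * (n : ℝ) ^ (3 / 2 - c)) := by ring
      _ = post L n (splitP n c) Y S := by
          rw [← Real.rpow_add hn0]; simp
  · obtain ⟨hTt, hST, hcard, -⟩ := hmoves.grow S hS T hT
    obtain ⟨i, hi, hiB⟩ := Finset.not_disjoint_iff.mp hdis
    have hiL := hass.B_depth i hiB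
    have hlow : ∀ j, (n : ℝ) ^ (-(c + 2)) ≤ nodeFactor n (splitP n c) Y j := fun j =>
      (le_mul_of_one_le_right (by positivity) (Real.one_le_exp (by positivity))).trans
        (rpow_mul_exp_le_nodeFactor Y j hn4 (by linarith))
    have hsig : (n : ℝ) ^ (-(c + 2)) * Real.exp (A ^ 2 * Real.log n ^ 2 / 4) ≤
        nodeFactor n (splitP n c) Y i := by
      refine le_trans ?_ (rpow_mul_exp_le_nodeFactor Y i hn4 (by linarith))
      refine mul_le_mul_of_nonneg_left (Real.exp_le_exp.mpr ?_) (by positivity)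
      rw [le_div_iff₀ (by positivity), hcol i hiL]
      refine le_trans ?_ (sq_colDot_signal_ge (show 0 < n by omega) hlog hA
        (hass.signal_low i hiB) (hgood i hiL))
      have : 0 ≤ A ^ 2 * Real.log n ^ 2 * (n - 8) :=
        mul_nonneg (by positivity) (by linarith)
      linarith
    have hprod : (n : ℝ) ^ (A ^ 2 * Real.log n / 8) ≤
        ∏ j ∈ T \ S, nodeFactor n (splitP n c) Y j := by
      calc (n : ℝ) ^ (A ^ 2 * Real.log n / 8)
          ≤ ((n : ℝ) ^ (-(c + 2))) ^ (T \ S).card * Real.exp (A ^ 2 * Real.log n ^ 2 / 4) := by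
            rw [← Real.rpow_natCast (_ ^ (-(c + 2))), ← Real.rpow_mul hn0.le, Real.rpow_def_of_pos hn0,
              Real.rpow_def_of_pos hn0, ← Real.exp_add, Real.exp_le_exp]
            have hcard' : ((T \ S).card : ℝ) ≤ 2 * Real.log n := by
              have : ((T \ S).card : ℝ) ≤ L + 1 := by exact_mod_cast hcard
              linarith
            have h1 : (c + 2) * Real.log n * (T \ S).card ≤
                (c + 2) * Real.log n * (2 * Real.log n) := by gcongr
            have h2 : 16 * (c + 2) * Real.log n ^ 2 ≤ A ^ 2 * Real.log n ^ 2 := by gcongr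
            linarith
        _ = ((n : ℝ) ^ (-(c + 2)) * Real.exp (A ^ 2 * Real.log n ^ 2 / 4)) *
            ∏ j ∈ (T \ S).erase i, (n : ℝ) ^ (-(c + 2)) := by
            rw [Finset.prod_const, Finset.card_erase_of_mem hi,
              ← mul_pow_sub_one (Finset.card_pos.mpr ⟨i, hi⟩).ne']
            ring
        _ ≤ nodeFactor n (splitP n c) Y i *
            ∏ j ∈ (T \ S).erase i, nodeFactor n (splitP n c) Y j := by
            have := (nodeFactor_pos (Y := Y) hp0 hp1 i).le
            gcongr with j hj
            exact hlow j
        _ = _ := Finset.mul_prod_erase _ _ hi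
    rw [post_eq_mul_prod hS hTt hST.subset, mul_comm]
    exact mul_le_mul_of_nonneg_left hprod (post_pos hp0 hp1 hS).le

lemma sq_mul_le_nOf (hm : 23 ≤ m) : (128 * (m + 1)) ^ 2 ≤ nOf m := by
  rw [nOf]
  induction m, hm using Nat.le_induction with
  | base => norm_num
  | succ m hm ih =>
    calc (128 * (m + 1 + 1)) ^ 2 ≤ (128 * (m + 1)) ^ 2 * 2 := by nlinarith
      _ ≤ 2 ^ (m + 1) * 2 := by gcongr
      _ = 2 ^ (m + 1 + 1) := (pow_succ _ _).symm

lemma largeSample (hm : 23 ≤ m) (hL : L ≤ m) (hc : 3 < c) (hAc : 16 * (c + 2) ≤ A ^ 2) :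
    LargeSample L (nOf m) c A := by
  have hsq : ((128 * (m + 1)) ^ 2 : ℝ) ≤ nOf m := by exact_mod_cast sq_mul_le_nOf hm
  have hlog := one_le_log_nOf (show 1 ≤ m by omega)
  have hm0 : (0 : ℝ) ≤ m := m.cast_nonneg
  have h2L : (2 : ℝ) ^ (L + 1) ≤ nOf m := by
    have : 2 ^ (L + 1) ≤ nOf m := Nat.pow_le_pow_right (by norm_num) (by omega)
    exact_mod_cast this
  have h2L' : (2 : ℝ) ^ L ≤ nOf m := le_trans (pow_le_pow_right₀ (by norm_num) (by omega)) h2L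
  set n := nOf m
  have hn128 : (128 : ℝ) ≤ n := by nlinarith
  have hn0 : (0 : ℝ) < n := by linarith
  have hcap : (n : ℝ) ^ (c + 4) ≤ (n : ℝ) ^ (A ^ 2 * Real.log n / 8) := by
    refine Real.rpow_le_rpow_of_exponent_le (by linarith) ?_
    have : A ^ 2 * 1 ≤ A ^ 2 * Real.log n := by gcongr
    linarith
  refine ⟨?_, ?_, ?_⟩
  · have hsqrt : 128 * ((m : ℝ) + 1) ≤ (n : ℝ) ^ (1 / 2 : ℝ) := by
      rw [← Real.sqrt_eq_rpow]
      exact Real.le_sqrt_of_sq_le hsq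
    have hLm : (L : ℝ) ≤ m := by exact_mod_cast hL
    calc 128 * (2 ^ L * ((L : ℝ) + 1)) = 2 ^ L * (128 * ((L : ℝ) + 1)) := by ring
      _ ≤ n * (128 * ((m : ℝ) + 1)) := by gcongr
      _ ≤ n * (n : ℝ) ^ (1 / 2 : ℝ) := by gcongr
      _ = (n : ℝ) ^ (1 + 1 / 2 : ℝ) := by rw [Real.rpow_add hn0, Real.rpow_one]
      _ ≤ (n : ℝ) ^ (c - 3 / 2) :=
          Real.rpow_le_rpow_of_exponent_le (by linarith) (by linarith)
  · refine le_trans ?_ hcap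
    calc (2 : ℝ) ^ L * (n : ℝ) ^ (c - 3 / 2) ≤ n * (n : ℝ) ^ (c - 3 / 2) := by gcongr
      _ = (n : ℝ) ^ (1 + (c - 3 / 2)) := by rw [Real.rpow_add hn0, Real.rpow_one]
      _ ≤ (n : ℝ) ^ (c + 4) :=
          Real.rpow_le_rpow_of_exponent_le (by linarith) (by linarith)
  · refine le_trans ?_ hcap
    calc 128 * ((2 : ℝ) ^ L * 2 ^ (L + 1)) ≤ n * (n * n) := by gcongr
      _ = (n : ℝ) ^ (3 : ℝ) := by
          rw [show (3 : ℝ) = (3 : ℕ) by norm_num, Real.rpow_natCast]; ring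
      _ ≤ (n : ℝ) ^ (c + 4) :=
          Real.rpow_le_rpow_of_exponent_le (by linarith) (by linarith)

end Dichotomy

/-! ### The mixing time on the high-probability event -/

/-- If the moves of an informed chain are suitable for the signal set, the mixing time bound holds
with probability at least `1 - 1 / n`. -/
lemma infP_mixTime_le_with_high_prob {L m : ℕ} {c A C : ℝ} {β : ℕ → ℝ} {B Sstar : Finset ℕ}
    {Ng Np : Finset ℕ → Finset (Finset ℕ)} (hm : 23 ≤ m) (hL : L ≤ m) (hc : 3 < c)
    (hA : 16 * (c + 2) ≤ A) (hass : Assumption1 L (nOf m) A C β B Sstar)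
    (hmoves : InformedMoves L B Sstar Ng Np) :
    ENNReal.ofReal (1 - 4 / (nOf m : ℝ) - Real.exp (-(nOf m : ℝ) / 8)) ≤
      gauss (nOf m) {ε | ∀ δ ∈ Set.Ioo (0 : ℝ) 1,
        (mixTime L (nOf m) (splitP (nOf m) c) (Yvec (nOf m) β B ε)
            (infP L (nOf m) c A (Yvec (nOf m) β B ε) Ng Np) δ : ℝ) ≤
          6 * Real.log (6 / δ) *
            max (9 * (C + 2) ^ 2 / A ^ 2 * (2 ^ L * (nOf m : ℝ) / Real.log (nOf m : ℝ) ^ 2))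
              (2 ^ (L + 5))} := by
  have hA8 : 8 ≤ A := by linarith
  have hAc : 16 * (c + 2) ≤ A ^ 2 := by nlinarith
  have hn : 0 < nOf m := by unfold nOf; positivity
  have hlarge := largeSample hm hL hc hAc
  have hpow : 2 ^ L ≤ 2 ^ m := Nat.pow_le_pow_right (by norm_num) hL
  have hLlog : (L : ℝ) + 1 ≤ 2 * Real.log (nOf m) := by
    have : (L : ℝ) ≤ m := by exact_mod_cast hL
    linarith [le_two_mul_log_nOf m]
  have hprob : ENNReal.ofReal (1 - 4 / (nOf m : ℝ) - Real.exp (-(nOf m : ℝ) / 8)) ≤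
      ENNReal.ofReal (1 - 1 / (nOf m : ℕ)) := by
    apply ENNReal.ofReal_le_ofReal
    have h1 := Real.exp_pos (-(nOf m : ℝ) / 8)
    have h2 : 1 / (nOf m : ℝ) ≤ 4 / nOf m := by gcongr; norm_num
    linarith
  have hnoise := one_sub_le_gauss_noise (N := 2 ^ L) hn
    (by rw [nOf, pow_succ]; omega)
    (fun j hj => by
      rw [Fin.sum_univ_eq_sum_range (fun i => haarCol (nOf m) j i ^ 2) (nOf m)]
      exact sum_haarCol_sq (hj.trans_le hpow))
  refine hprob.trans (hnoise.trans (measure_mono fun ε hε δ hδ => ?_))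
  have hd : PosteriorDichotomy L (nOf m) c A (Yvec (nOf m) β B ε) B Ng :=
    posteriorDichotomy (eight_le_nOf (by omega)) (one_le_log_nOf (by omega)) hLlog hc hA8 hAc hass
      (fun j hj => colDot_Yvec hL hass.B_depth hass.support ε hj) hε hmoves
  have hlog : 0 ≤ Real.log (6 / δ) := by
    apply Real.log_nonneg
    rw [le_div_iff₀ hδ.1]
    linarith [hδ.2]
  refine (infP_mixTime_le hass.Sstar_contains hass.Sstar_tree hass.Sstar_min hmoves hd hlarge
    hδ).trans ?_
  exact mul_le_mul_of_nonneg_left (le_max_right _ _) (by positivity)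

/-- **Theorem 5 (Linear mixing for locally informed proposals).**
Assume the Bayesian CART prior with `p_{lk} = n^{-c}`, `c > 3`, consider the informed
(LIT-MH) Twiggy Bayesian CART chain, and let `L = L(n) ≤ L_max` with `L(n) → ∞`
(here all quantities are indexed by `m = L_max`, `n = 2^{m+1}`).  Under Assumption 1
(case (a) or (b)) with sufficiently large `A > 0`, there is a universal constant `c₀`
such that for all sufficiently large `n`, with probability at least
`1 − 4/n − e^{−n/8}` over `ε ~ N(0, I_n)`,
`τ_δ ≤ c₀ log(6/δ) max((9(C_{f₀}+2)²/A²)·2^L n/log²n, 2^{L+5})`.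
For the informed Bayesian CART chain the same bound holds, but only under
Assumption 1(a). -/
theorem informed_mixing_upper_bound (c : ℝ) (hc : 3 < c) :
    ∃ c₀ : ℝ, 0 < c₀ ∧
      ∀ L : ℕ → ℕ, (∀ m, L m ≤ m) →
        Filter.Tendsto L Filter.atTop Filter.atTop →
      ∃ A₀ : ℝ, 0 < A₀ ∧ ∀ A ≥ A₀,
      ∀ (C : ℝ) (β : ℕ → ℕ → ℝ) (B Sstar : ℕ → Finset ℕ),
      (∀ m, Assumption1 (L m) (nOf m) A C (β m) (B m) (Sstar m)) →
      ∃ M : ℕ, ∀ m ≥ M,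
        (ENNReal.ofReal (1 - 4 / (nOf m : ℝ) - Real.exp (-(nOf m : ℝ) / 8)) ≤
          gauss (nOf m) {ε | ∀ δ ∈ Set.Ioo (0 : ℝ) 1,
            (mixTime (L m) (nOf m) (splitP (nOf m) c) (Yvec (nOf m) (β m) (B m) ε)
                (infTwiggyP (L m) (nOf m) c A (Yvec (nOf m) (β m) (B m) ε)) δ : ℝ) ≤
              c₀ * Real.log (6 / δ) *
                max (9 * (C + 2) ^ 2 / A ^ 2 *
                      (2 ^ L m * (nOf m : ℝ) / Real.log (nOf m : ℝ) ^ 2))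
                  (2 ^ (L m + 5))}) ∧
        (Sstar m = B m →
          ENNReal.ofReal (1 - 4 / (nOf m : ℝ) - Real.exp (-(nOf m : ℝ) / 8)) ≤
            gauss (nOf m) {ε | ∀ δ ∈ Set.Ioo (0 : ℝ) 1,
              (mixTime (L m) (nOf m) (splitP (nOf m) c) (Yvec (nOf m) (β m) (B m) ε)
                  (infBcartP (L m) (nOf m) c A (Yvec (nOf m) (β m) (B m) ε)) δ : ℝ) ≤
                c₀ * Real.log (6 / δ) *
                  max (9 * (C + 2) ^ 2 / A ^ 2 *
                        (2 ^ L m * (nOf m : ℝ) / Real.log (nOf m : ℝ) ^ 2))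
                    (2 ^ (L m + 5))}) := by
  refine ⟨6, by norm_num, fun L hL _ => ⟨16 * (c + 2), by linarith, fun A hA C β B Sstar hass =>
    ⟨23, fun m hm => ⟨?_, fun hSB => ?_⟩⟩⟩⟩
  · exact infP_mixTime_le_with_high_prob hm (hL m) hc hA (hass m)
      (informedMoves_twiggy (hass m).Sstar_contains (hass m).Sstar_tree (hass m).Sstar_min)
  · refine infP_mixTime_le_with_high_prob hm (hL m) hc hA (hass m) ?_
    have h := informedMoves_bcart (hass m).Sstar_tree
    rwa [hSB] at h ⊢

end BayesCART
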